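/- arXiv:1807.00391 — 3 statements merged into one kernel-verified Lean document; each statement's English description precedes it below -/
import Mathlib

section
/- Let N ≥ 1 and k ≥ 3 be integers, a, b ∈ ℤ/Nℤ, g = (A, B; C, D) ∈ SL₂(ℤ), and let σ be a field automorphism of ℂ with σ(ζ_N) = ζ_N^λ for an integer λ coprime to N; fix λ' ∈ ℤ with λλ' ≡ 1 (mod N), and let g_λ ∈ SL₂(ℤ) be any matrix with g_λ ≡ (A, λB; λ'C, D) (mod N). Then for every n ≥ 0 one has σ(a_n(E^{(k)}_{a,b} |_k g)) = a_n(E^{(k)}_{a,λb} |_k g_λ), i.e. applying σ to the Fourier coefficients of E^{(k)}_{a,b} |_k g yields the Fourier coefficients of E^{(k)}_{a,λb} |_k g_λ. -/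
open Complex UpperHalfPlane CongruenceSubgroup
open scoped ModularForm MatrixGroups Real

noncomputable section

/-- `ζ_N = e^{2πi/N}`. -/
def zetaC (N : ℕ) : ℂ := Complex.exp (2 * Real.pi * Complex.I / N)

/-- `f` has the Fourier expansion `Σ_{n ≥ 0} c n · e^{2πinτ/N}`. -/
def HasExpansion (N : ℕ) (f : ℍ → ℂ) (c : ℕ → ℂ) : Prop :=
  ∀ τ : ℍ, HasSum (fun n : ℕ => c n * Complex.exp (2 * Real.pi * Complex.I * n * (τ : ℂ) / N)) (f τ)

/-- The Eisenstein series `E^{(k)}_{a,b}` of weight `k` and level `N`: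
`E^{(k)}_{a,b}(τ) = ((k−1)!/(−2πi)^k) · Σ_{ω ∈ ℤτ+ℤ, ω ≠ −(ãτ+b̃)/N} (ω + (ãτ+b̃)/N)^{−k}`.
Writing `ω = mτ + n`, the summand is `N^k/((mN+ã)τ + (nN+b̃))^k`; the single excluded
term is the one whose denominator vanishes, which in Lean contributes `0` anyway. -/
def Eis (k N : ℕ) (a b : ZMod N) : ℍ → ℂ := fun τ =>
  ((k - 1).factorial : ℂ) / (-(2 * Real.pi * Complex.I)) ^ k *
    ∑' p : ℤ × ℤ,
      (N : ℂ) ^ k /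
        (((p.1 * N + (a.val : ℤ) : ℤ) : ℂ) * (τ : ℂ) + ((p.2 * N + (b.val : ℤ) : ℤ) : ℂ)) ^ k



lemma exp_unique (N : ℕ) [NeZero N] (f : ℍ → ℂ) (c c' : ℕ → ℂ)
    (h : HasExpansion N f c) (h' : HasExpansion N f c') : c = c' := by
  have key : ∀ q : ℂ, q ≠ 0 → ‖q‖ < 1 → HasSum (fun n => q ^ n • (c n - c' n)) 0 := by
    intro q hq0 hq
    have hN : (N : ℂ) ≠ 0 := NeZero.ne _
    have hNr : (0 : ℝ) < N := by exact_mod_cast NeZero.pos N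
    obtain ⟨w, hw⟩ : ∃ w, Complex.exp w = q := ⟨Complex.log q, Complex.exp_log hq0⟩
    have hre : w.re < 0 := by
      rw [← hw, Complex.norm_exp] at hq
      simpa using hq
    have him : 0 < (w * N / (2 * Real.pi * Complex.I)).im := by
      have : w * N / (2 * Real.pi * Complex.I) = ((N / (2 * Real.pi) : ℝ) : ℂ) * (-Complex.I * w) := by
        have := Real.pi_ne_zero
        push_cast
        field_simp
        rw [Complex.I_sq]; ring
      rw [this, Complex.im_ofReal_mul]
      have h2 : (-Complex.I * w).im = - w.re := by simp
      rw [h2]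
      have := Real.pi_pos
      have : 0 < -w.re := by linarith
      positivity
    have e : ∀ n : ℕ, Complex.exp (2 * Real.pi * Complex.I * n * (w * N / (2 * Real.pi * Complex.I)) / N) = q ^ n := by
      intro n
      rw [← hw, ← Complex.exp_nat_mul]
      congr 1
      have : (Real.pi : ℂ) ≠ 0 := by exact_mod_cast Real.pi_ne_zero
      field_simp
    have h1 := (h ⟨_, him⟩).sub (h' ⟨_, him⟩)
    simp only [e, sub_self] at h1
    have h2 : (fun n => q ^ n • (c n - c' n)) = fun n => c n * q ^ n - c' n * q ^ n := by
      funext n; rw [smul_eq_mul]; ring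
    rw [h2]; exact h1
  have key2 : HasFPowerSeriesAt (fun q : ℂ => if q = 0 then c 0 - c' 0 else 0)
      (FormalMultilinearSeries.ofScalars ℂ (fun n => c n - c' n)) 0 := by
    rw [hasFPowerSeriesAt_iff]
    filter_upwards [Metric.ball_mem_nhds (0 : ℂ) one_pos] with q hq
    simp only [zero_add, FormalMultilinearSeries.coeff_ofScalars]
    split_ifs with h0
    · subst h0
      convert hasSum_single 0 ?_ using 1
      · simp
      · intro n hn; simp [hn]
    · exact key q h0 (by simpa using hq)
  have h0 : c 0 - c' 0 = 0 := by
    have hc := key2.continuousAt.tendsto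
    rw [if_pos rfl] at hc
    have h2 : Filter.Tendsto (fun q : ℂ => if q = 0 then c 0 - c' 0 else 0) (nhdsWithin 0 {0}ᶜ)
        (nhds 0) := by
      refine tendsto_const_nhds.congr' ?_
      filter_upwards [self_mem_nhdsWithin] with q hq
      exact (if_neg hq).symm
    exact tendsto_nhds_unique (hc.mono_left nhdsWithin_le_nhds) h2
  simp only [h0, ite_self] at key2
  have := HasFPowerSeriesAt.eq_zero key2
  funext n
  have h3 := congrArg (fun p => FormalMultilinearSeries.coeff p n) this
  simp only [FormalMultilinearSeries.coeff_ofScalars] at h3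
  exact sub_eq_zero.mp (by simpa [FormalMultilinearSeries.coeff] using h3)

/-- The full lattice sum with indicator. -/
def TS (k N : ℕ) (a b : ZMod N) (τ : ℍ) : ℂ :=
  ∑' p : ℤ × ℤ, if ((p.1 : ZMod N) = a ∧ (p.2 : ZMod N) = b) then 1 / ((p.1 : ℂ) * τ + p.2) ^ k else 0

lemma zmod_lift (N : ℕ) [NeZero N] (a : ZMod N) (m : ℤ) (h : (m : ZMod N) = a) :
    ∃ t : ℤ, t * N + (a.val : ℤ) = m := by
  have : (m : ZMod N) = ((a.val : ℤ) : ZMod N) := by simp [h]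
  rw [ZMod.intCast_eq_intCast_iff_dvd_sub] at this
  obtain ⟨t, ht⟩ := this
  exact ⟨-t, by linarith⟩

lemma Eis_eq (k N : ℕ) [NeZero N] (a b : ZMod N) (τ : ℍ) :
    Eis k N a b τ = ((k - 1).factorial : ℂ) / (-(2 * Real.pi * Complex.I)) ^ k *
      ((N : ℂ) ^ k * TS k N a b τ) := by
  unfold Eis TS
  congr 1
  rw [← tsum_mul_left]
  have hN : (N : ℤ) ≠ 0 := by exact_mod_cast NeZero.ne N
  have hinj : Function.Injective (fun p : ℤ × ℤ => (p.1 * N + (a.val : ℤ), p.2 * N + (b.val : ℤ))) := by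
    rintro ⟨x, y⟩ ⟨x', y'⟩ h
    have h1 := congrArg Prod.fst h
    have h2 := congrArg Prod.snd h
    simp only [add_left_inj, mul_eq_mul_right_iff, hN, or_false] at h1 h2
    rw [h1, h2]
  refine Eq.trans ?_ (hinj.tsum_eq ?_)
  · apply tsum_congr
    intro p
    simp [div_eq_mul_inv]
  · intro p hp
    simp only [Function.mem_support, ne_eq, mul_eq_zero, not_or, ite_eq_right_iff, Classical.not_imp] at hp
    obtain ⟨_, ⟨h1, h2⟩, _⟩ := hp
    obtain ⟨t, ht⟩ := zmod_lift N a _ h1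
    obtain ⟨s, hs⟩ := zmod_lift N b _ h2
    exact ⟨(t, s), Prod.ext ht hs⟩

/-- The action of `g` on row vectors. -/
def rowEquiv (g : SL(2, ℤ)) : ℤ × ℤ ≃ ℤ × ℤ where
  toFun p := (p.1 * g 0 0 + p.2 * g 1 0, p.1 * g 0 1 + p.2 * g 1 1)
  invFun p := (p.1 * g 1 1 - p.2 * g 1 0, - p.1 * g 0 1 + p.2 * g 0 0)
  left_inv p := by
    have := g.det_coe
    rw [Matrix.det_fin_two] at this
    ext
    · simp only; linear_combination p.1 * this
    · simp only; linear_combination p.2 * this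
  right_inv p := by
    have := g.det_coe
    rw [Matrix.det_fin_two] at this
    ext
    · simp only; linear_combination p.1 * this
    · simp only; linear_combination p.2 * this

lemma TS_slash (k N : ℕ) (a b : ZMod N) (g : SL(2, ℤ)) (τ : ℍ) :
    TS k N a b (g • τ) * denom g τ ^ (-(k : ℤ)) =
      TS k N (a * (g 0 0 : ℤ) + b * (g 1 0 : ℤ)) (a * (g 0 1 : ℤ) + b * (g 1 1 : ℤ)) τ := by
  unfold TS
  conv_rhs => rw [← (rowEquiv g).tsum_eq]
  rw [← tsum_mul_right]
  apply tsum_congr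
  intro p
  have hd : denom g τ = (g 1 0 : ℂ) * τ + (g 1 1 : ℂ) := by
    simp [denom]
  have hd0 : denom g τ ≠ 0 := denom_ne_zero _ _
  have hcond : ((p.1 : ZMod N) = a ∧ (p.2 : ZMod N) = b) ↔
     ((((rowEquiv g p).1 : ℤ) : ZMod N) = a * (g 0 0 : ℤ) + b * (g 1 0 : ℤ) ∧
      (((rowEquiv g p).2 : ℤ) : ZMod N) = a * (g 0 1 : ℤ) + b * (g 1 1 : ℤ)) := by
    simp only [rowEquiv, Equiv.coe_fn_mk]
    push_cast
    constructor
    · rintro ⟨rfl, rfl⟩; simp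
    · rintro ⟨h1, h2⟩
      have := congrArg (fun z : ℤ => (z : ZMod N)) g.det_coe
      rw [Matrix.det_fin_two] at this
      push_cast at this
      constructor
      · linear_combination (g 1 1 : ZMod N) * h1 - (g 1 0 : ZMod N) * h2 - (p.1 - a) * this
      · linear_combination -(g 0 1 : ZMod N) * h1 + (g 0 0 : ZMod N) * h2 - (p.2 - b) * this
  by_cases h : ((p.1 : ZMod N) = a ∧ (p.2 : ZMod N) = b)
  · rw [if_pos h, if_pos (hcond.mp h)]
    rw [zpow_neg, zpow_natCast, one_div, one_div, ← mul_inv, ← mul_pow]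
    congr 2
    rw [coe_specialLinearGroup_apply]
    simp only [rowEquiv, Equiv.coe_fn_mk]
    rw [hd] at hd0 ⊢
    simp only [algebraMap_int_eq, eq_intCast, ofReal_intCast]
    push_cast
    have aux : ∀ X D p q : ℂ, D ≠ 0 → (p * (X / D) + q) * D = p * X + q * D := by
      intro X D p q h; field_simp
    rw [aux _ _ _ _ hd0]
    ring
  · rw [if_neg h, if_neg (hcond.not.mp h), zero_mul]

/-- Inner sum. -/
def HS (k N : ℕ) (b : ZMod N) (m : ℤ) (τ : ℍ) : ℂ :=
  ∑' n : ℤ, if (n : ZMod N) = b then 1 / ((m : ℂ) * τ + n) ^ k else 0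

lemma HS_neg (k N : ℕ) (b : ZMod N) (m : ℤ) (τ : ℍ) :
    HS k N b (-m) τ = (-1) ^ k * HS k N (-b) m τ := by
  unfold HS
  rw [← tsum_mul_left, ← (Equiv.neg ℤ).tsum_eq]
  apply tsum_congr
  intro n
  simp only [Equiv.neg_apply, Int.cast_neg, neg_eq_iff_eq_neg, mul_ite, mul_zero]
  congr 1
  rw [show -(m : ℂ) * τ + -n = (-1) * (m * τ + n) by ring, mul_pow, one_div, mul_inv, one_div]
  congr 1
  rw [← inv_pow]; norm_num

lemma HS_lift (k N : ℕ) [NeZero N] (b : ZMod N) (m : ℤ) (τ : ℍ) :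
    HS k N b m τ = ∑' t : ℤ, 1 / ((m : ℂ) * τ + (t * N + (b.val : ℤ) : ℤ)) ^ k := by
  unfold HS
  symm
  have hN : (N : ℤ) ≠ 0 := by exact_mod_cast NeZero.ne N
  have hinj : Function.Injective (fun t : ℤ => t * N + (b.val : ℤ)) := by
    intro x y h
    simpa only [add_left_inj, mul_eq_mul_right_iff, hN, or_false] using h
  refine Eq.trans ?_ (hinj.tsum_eq ?_)
  · apply tsum_congr
    intro p
    simp
  · intro p hp
    simp only [Function.mem_support, ne_eq, ite_eq_right_iff, Classical.not_imp] at hp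
    obtain ⟨t, ht⟩ := zmod_lift N b _ hp.1
    exact ⟨t, ht⟩

/-- The nome. -/
def qq (N : ℕ) (τ : ℍ) : ℂ := Complex.exp (2 * Real.pi * Complex.I * τ / N)

lemma norm_qq (N : ℕ) [NeZero N] (τ : ℍ) : ‖qq N τ‖ < 1 := by
  have hN : (0 : ℝ) < N := by exact_mod_cast NeZero.pos N
  unfold qq
  rw [Complex.norm_exp, Real.exp_lt_one_iff]
  have : (2 * Real.pi * Complex.I * τ / N : ℂ) = ((2 * Real.pi / N : ℝ) : ℂ) * (Complex.I * τ) := by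
    push_cast; ring
  rw [this, Complex.re_ofReal_mul]
  have h2 : (Complex.I * (τ : ℂ)).re = - τ.im := by simp
  rw [h2]
  have := τ.im_pos
  have : 0 < 2 * Real.pi / N * τ.im := by have := Real.pi_pos; positivity
  linarith

lemma HS_pos (k N : ℕ) [NeZero N] (hk : 3 ≤ k) (b : ZMod N) (m : ℕ+) (τ : ℍ) :
    ((k - 1).factorial : ℂ) / (-(2 * Real.pi * Complex.I)) ^ k * ((N : ℂ) ^ k *
      HS k N b (m : ℕ) τ) =
      ∑' d : ℕ+, ((d : ℕ) : ℂ) ^ (k - 1) * (ZMod.stdAddChar (((d : ℕ) : ZMod N) * b) *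
        qq N τ ^ ((m : ℕ) * (d : ℕ))) := by
  have hN : (N : ℂ) ≠ 0 := NeZero.ne _
  have hNr : (0 : ℝ) < N := by exact_mod_cast NeZero.pos N
  have him : 0 < ((((m : ℕ) : ℂ) * τ + b.val) / N).im := by
    have : ((((m : ℕ) : ℂ) * τ + b.val) / N) = ((1 / N : ℝ) : ℂ) * (((m : ℕ) : ℝ) * τ + (b.val : ℝ)) := by
      push_cast; ring
    rw [this, Complex.im_ofReal_mul, Complex.add_im, Complex.im_ofReal_mul]
    have := τ.im_pos
    have hm : (0 : ℝ) < ((m : ℕ) : ℝ) := by exact_mod_cast m.pos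
    simp only [Complex.ofReal_im, add_zero, UpperHalfPlane.coe_im]
    positivity
  have H := EisensteinSeries.qExpansion_identity_pnat (k := k - 1) (by omega) ⟨_, him⟩
  rw [show k - 1 + 1 = k by omega] at H
  have e1 : (N : ℂ) ^ k * HS k N b (m : ℕ) τ =
      ∑' n : ℤ, 1 / (((((m : ℕ) : ℂ) * τ + b.val) / N) + n) ^ k := by
    rw [HS_lift, ← tsum_mul_left]
    apply tsum_congr
    intro t
    have : ((m : ℕ) : ℂ) * τ + (t * N + b.val) = N * ((((m : ℕ) : ℂ) * τ + b.val) / N + t) := by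
      field_simp; ring
    push_cast
    rw [this, mul_pow]
    rw [one_div, mul_inv, one_div, mul_inv_cancel_left₀ (pow_ne_zero _ hN)]
  rw [e1]
  simp only at H
  rw [H, ← mul_assoc]
  have hpi : (-(2 * Real.pi * Complex.I) : ℂ) ^ k ≠ 0 := by
    apply pow_ne_zero
    simp [Real.pi_ne_zero]
  have e2 : (((k - 1).factorial : ℂ) / (-(2 * Real.pi * Complex.I)) ^ k *
    ((-2 * Real.pi * Complex.I) ^ k / ((k - 1).factorial : ℂ))) = 1 := by
    rw [show (-2 * Real.pi * Complex.I : ℂ) = -(2 * Real.pi * Complex.I) by ring]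
    have : ((k - 1).factorial : ℂ) ≠ 0 := by exact_mod_cast Nat.factorial_ne_zero _
    field_simp
  rw [e2, one_mul]
  apply tsum_congr
  intro d
  congr 1
  have : ((d : ℕ) : ZMod N) * b = (((d : ℕ) * b.val : ℤ) : ZMod N) := by simp
  rw [this, ZMod.stdAddChar_coe, qq, ← Complex.exp_nat_mul, ← Complex.exp_nat_mul, ← Complex.exp_add]
  congr 1
  push_cast
  field_simp
  ring

/-- Constant term. -/
def constC (k N : ℕ) [NeZero N] (b : ZMod N) : ℂ :=
  (N : ℂ) ^ k / N * ∑ j : ZMod N, ZMod.stdAddChar (-(j * b)) *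
    ((-1) ^ (k + 1) / k * (((Polynomial.bernoulli k).eval ((j.val : ℚ) / N) : ℚ) : ℂ))

lemma HS_zero (k N : ℕ) [NeZero N] (hk : 3 ≤ k) (b : ZMod N) (τ : ℍ) :
    ((k - 1).factorial : ℂ) / (-(2 * Real.pi * Complex.I)) ^ k * ((N : ℂ) ^ k *
      HS k N b 0 τ) = constC k N b := by
  have hN : (N : ℂ) ≠ 0 := NeZero.ne _
  have hNr : (0 : ℝ) < N := by exact_mod_cast NeZero.pos N
  have h1 : ∀ j : ZMod N, HasSum (fun n : ℤ => ZMod.stdAddChar (-(j * b)) *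
      (1 / (n : ℂ) ^ k * ZMod.stdAddChar (j * (n : ZMod N))))
      (ZMod.stdAddChar (-(j * b)) * (-(2 * Real.pi * Complex.I) ^ k / k.factorial *
        (((Polynomial.bernoulli k).eval ((j.val : ℚ) / N) : ℚ) : ℂ))) := by
    intro j
    apply HasSum.mul_left
    have hx : ((j.val : ℝ) / N) ∈ Set.Icc (0 : ℝ) 1 := by
      constructor
      · positivity
      · rw [div_le_one hNr]
        exact_mod_cast (ZMod.val_lt j).le
    have := hasSum_one_div_pow_mul_fourier_mul_bernoulliFun (k := k) (by omega) hx
    have eA : (fun n : ℤ => 1 / (n : ℂ) ^ k * ZMod.stdAddChar (j * (n : ZMod N))) =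
        fun n : ℤ => 1 / (n : ℂ) ^ k * fourier n (((j.val : ℝ) / N : ℝ) : UnitAddCircle) := by
      funext n
      congr 1
      rw [fourier_coe_apply]
      have : j * (n : ZMod N) = ((j.val * n : ℤ) : ZMod N) := by simp
      rw [this, ZMod.stdAddChar_coe]
      congr 1
      push_cast
      field_simp
    have eB : (((Polynomial.bernoulli k).eval ((j.val : ℚ) / N) : ℚ) : ℂ) =
        ((bernoulliFun k ((j.val : ℝ) / N) : ℝ) : ℂ) := by
      have : bernoulliFun k ((j.val : ℝ) / N) =
          (((Polynomial.bernoulli k).eval ((j.val : ℚ) / N) : ℚ) : ℝ) := by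
        unfold bernoulliFun
        have h3 := Polynomial.eval_map_algebraMap (B := ℝ) (Polynomial.bernoulli k) (((j.val : ℚ) / N : ℚ) : ℝ)
        have h4 := Polynomial.aeval_algebraMap_apply ℝ ((j.val : ℚ) / N) (Polynomial.bernoulli k)
        simp only [eq_ratCast] at h4
        rw [h4] at h3
        push_cast at h3
        rw [h3]
        simp
      rw [this]
      simp
    rw [eA, eB]
    exact this
  have h2 := hasSum_sum (s := Finset.univ) (fun j _ => h1 j)
  have h3 : HS k N b 0 τ = 1 / N * ∑ j : ZMod N, (ZMod.stdAddChar (-(j * b)) * (-(2 * Real.pi * Complex.I) ^ k / k.factorial *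
        (((Polynomial.bernoulli k).eval ((j.val : ℚ) / N) : ℚ) : ℂ))) := by
    unfold HS
    rw [← (h2.mul_left (1 / (N : ℂ))).tsum_eq]
    apply tsum_congr
    intro n
    have h5 : ∑ j : ZMod N, ZMod.stdAddChar (-(j * b)) *
      (1 / (n : ℂ) ^ k * ZMod.stdAddChar (j * (n : ZMod N))) =
      1 / (n : ℂ) ^ k * ∑ j : ZMod N, ZMod.stdAddChar (j * ((n : ZMod N) - b)) := by
      rw [Finset.mul_sum]
      apply Finset.sum_congr rfl
      intro j _
      rw [show j * ((n : ZMod N) - b) = -(j * b) + j * n by ring, AddChar.map_add_eq_mul]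
      ring
    rw [h5, AddChar.sum_mulShift _ (ZMod.isPrimitive_stdAddChar N)]
    simp only [sub_eq_zero, ZMod.card, Int.cast_zero, zero_mul, zero_add]
    split_ifs
    · field_simp
    · simp
  rw [h3, constC]
  have hpi : (2 * Real.pi * Complex.I : ℂ) ^ k ≠ 0 := by
    apply pow_ne_zero
    simp [Real.pi_ne_zero]
  have hpi' : (-(2 * Real.pi * Complex.I) : ℂ) ^ k = (-1) ^ k * (2 * Real.pi * Complex.I : ℂ) ^ k := by
    rw [← mul_pow]; ring
  rw [hpi', ← mul_assoc, ← mul_assoc, Finset.mul_sum, Finset.mul_sum]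
  apply Finset.sum_congr rfl
  intro j _
  obtain ⟨l, rfl⟩ : ∃ l, k = l + 1 := ⟨k - 1, by omega⟩
  have hl : ((l.factorial : ℕ) : ℂ) ≠ 0 := by exact_mod_cast Nat.factorial_ne_zero _
  have hl' : ((l : ℂ) + 1) ≠ 0 := by exact_mod_cast Nat.succ_ne_zero l
  have hs : ((-1 : ℂ) ^ (l + 1)) * (-1) ^ (l + 1) = 1 := by rw [← mul_pow]; norm_num
  have hs' : (-1 : ℂ) ^ (l + 1) ≠ 0 := by simp
  have hs2 : (-1 : ℂ) ^ (l + 1 + 1) = - (1 / (-1) ^ (l + 1)) := by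
    rw [← eq_div_of_mul_eq hs' hs, pow_succ _ (l + 1)]; ring
  rw [hs2, Nat.factorial_succ, Nat.add_sub_cancel]
  push_cast
  generalize (2 * Real.pi * Complex.I : ℂ) ^ (l + 1) = P at *
  generalize (-1 : ℂ) ^ (l + 1) = S at *
  generalize (N : ℂ) ^ (l + 1) = R at *
  field_simp

/-- Divisor-sum coefficients. -/
def coefC (k N : ℕ) [NeZero N] (a b : ZMod N) (n : ℕ) : ℂ :=
  ∑ x ∈ n.divisorsAntidiagonal, if (x.1 : ZMod N) = a then
    (x.2 : ℂ) ^ (k - 1) * ZMod.stdAddChar ((x.2 : ZMod N) * b) else 0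

lemma hasSum_coef (k N : ℕ) [NeZero N] (a b : ZMod N) (τ : ℍ) :
    HasSum (fun n : ℕ => coefC k N a b n * qq N τ ^ n)
      (∑' m : ℕ+, if ((m : ℕ) : ZMod N) = a then
        ∑' d : ℕ+, ((d : ℕ) : ℂ) ^ (k - 1) * (ZMod.stdAddChar (((d : ℕ) : ZMod N) * b) *
        qq N τ ^ ((m : ℕ) * (d : ℕ))) else 0) := by
  set F : ℕ × ℕ → ℂ := fun p => if (p.1 : ZMod N) = a then
        (p.2 : ℂ) ^ (k - 1) * (ZMod.stdAddChar ((p.2 : ZMod N) * b) *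
        qq N τ ^ (p.1 * p.2)) else 0 with hF
  have hs : Summable (fun p : ℕ+ × ℕ+ => F (p.1, p.2)) := by
    refine Summable.of_norm_bounded (summable_prod_mul_pow (k - 1) (norm_qq N τ)).norm ?_
    intro p
    simp only [hF]
    split_ifs
    · simp only [norm_mul, ZMod.stdAddChar_apply, Circle.norm_coe, one_mul]
      exact le_rfl
    · simp only [norm_zero]; positivity
  have e1 : (∑' m : ℕ+, if ((m : ℕ) : ZMod N) = a then
        ∑' d : ℕ+, ((d : ℕ) : ℂ) ^ (k - 1) * (ZMod.stdAddChar (((d : ℕ) : ZMod N) * b) *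
        qq N τ ^ ((m : ℕ) * (d : ℕ))) else 0) = ∑' p : ℕ+ × ℕ+, F (p.1, p.2) := by
    rw [hs.tsum_prod]
    apply tsum_congr
    intro m
    simp only [hF]
    split_ifs <;> simp
  rw [e1]
  have h2 := (sigmaAntidiagonalEquivProd.hasSum_iff).mpr hs.hasSum
  have h3 := h2.sigma (g := fun n : ℕ+ => coefC k N a b n * qq N τ ^ (n : ℕ)) (by
    intro n
    convert hasSum_fintype _ using 1
    rw [coefC, Finset.sum_mul, ← Finset.sum_coe_sort]
    apply Finset.sum_congr rfl
    rintro ⟨⟨x, y⟩, hx⟩ _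
    have hxy := (Nat.mem_divisorsAntidiagonal.mp hx).1
    simp only at hxy
    simp only [Function.comp, hF, sigmaAntidiagonalEquivProd, divisorsAntidiagonalFactors,
      Equiv.coe_fn_mk, PNat.mk_coe, hxy]
    split_ifs
    · ring
    · simp)
  have h4 : Function.support (fun n : ℕ => coefC k N a b n * qq N τ ^ n) ⊆
      Set.range ((↑) : ℕ+ → ℕ) := by
    intro n hn
    rcases Nat.eq_zero_or_pos n with rfl | h
    · simp [coefC] at hn
    · exact ⟨⟨n, h⟩, rfl⟩
  exact (PNat.coe_injective.hasSum_iff (fun n hn => by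
    by_contra h; exact hn (h4 h))).mp h3

/-- All Fourier coefficients. -/
def cfC (k N : ℕ) [NeZero N] (a b : ZMod N) (n : ℕ) : ℂ :=
  (if n = 0 then (if (0 : ZMod N) = a then constC k N b else 0) else 0) + coefC k N a b n
    + (-1) ^ k * coefC k N (-a) (-b) n

lemma TS_eq (k N : ℕ) (hk : 3 ≤ k) (a b : ZMod N) (τ : ℍ) :
    TS k N a b τ = (if (0 : ZMod N) = a then HS k N b 0 τ else 0) +
      (∑' m : ℕ+, if ((m : ℕ) : ZMod N) = a then HS k N b (m : ℕ) τ else 0) +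
      (∑' m : ℕ+, if ((m : ℕ) : ZMod N) = -a then (-1) ^ k * HS k N (-b) (m : ℕ) τ else 0) := by
  have hs : Summable (fun p : ℤ × ℤ => if ((p.1 : ZMod N) = a ∧ (p.2 : ZMod N) = b) then
      1 / ((p.1 : ℂ) * τ + p.2) ^ k else 0) := by
    refine Summable.of_norm_bounded (summable_prod_eisSummand hk τ).norm ?_
    intro p
    split_ifs
    · simp [EisensteinSeries.eisSummand]
    · simp only [norm_zero]; positivity
  have e : ∀ m : ℤ, (∑' n : ℤ, if ((m : ZMod N) = a ∧ (n : ZMod N) = b) then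
      1 / ((m : ℂ) * τ + n) ^ k else 0) = if (m : ZMod N) = a then HS k N b m τ else 0 := by
    intro m
    unfold HS
    split_ifs with h <;> simp [h]
  have hs2 := hs.prod
  simp only [e] at hs2
  unfold TS
  rw [hs.tsum_prod]
  simp only [e]
  rw [tsum_int_eq_zero_add_tsum_pnat hs2]
  simp only [HS_neg, Int.cast_neg, Int.cast_natCast, Int.cast_zero, neg_eq_iff_eq_neg]

lemma Eis_expansion (k N : ℕ) [NeZero N] (hk : 3 ≤ k) (a b : ZMod N) :
    HasExpansion N (Eis k N a b) (cfC k N a b) := by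
  intro τ
  have e0 : ∀ n : ℕ, Complex.exp (2 * Real.pi * Complex.I * n * (τ : ℂ) / N) = qq N τ ^ n := by
    intro n
    rw [qq, ← Complex.exp_nat_mul]; congr 1; ring
  simp only [e0]
  have h0 : HasSum (fun n : ℕ => (if n = 0 then (if (0 : ZMod N) = a then constC k N b else 0)
      else 0) * qq N τ ^ n) (if (0 : ZMod N) = a then constC k N b else 0) := by
    convert hasSum_single 0 ?_ using 1
    · simp
    · intro n hn; simp [hn]
  have H := (h0.add (hasSum_coef k N a b τ)).add ((hasSum_coef k N (-a) (-b) τ).mul_left ((-1) ^ k))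
  have e1 : (fun n => cfC k N a b n * qq N τ ^ n) = fun n => (if n = 0 then (if (0 : ZMod N) = a then constC k N b else 0)
      else 0) * qq N τ ^ n + coefC k N a b n * qq N τ ^ n +
        (-1) ^ k * (coefC k N (-a) (-b) n * qq N τ ^ n) := by
    funext n; unfold cfC; ring
  rw [e1]
  convert H using 1
  rw [Eis_eq, TS_eq k N hk, mul_add, mul_add, mul_add, mul_add]
  simp only [← HS_pos k N hk]
  congr 1
  · congr 1
    · split_ifs
      · rw [HS_zero k N hk]
      · simp
    · rw [← tsum_mul_left, ← tsum_mul_left]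
      apply tsum_congr
      intro m
      split_ifs <;> simp
  · rw [← tsum_mul_left, ← tsum_mul_left, ← tsum_mul_left]
    apply tsum_congr
    intro m
    split_ifs
    · ring
    · simp

lemma slash_Eis (k N : ℕ) [NeZero N] (a b : ZMod N) (g : SL(2, ℤ)) :
    (Eis k N a b ∣[(k : ℤ)] g) =
      Eis k N (a * (g 0 0 : ℤ) + b * (g 1 0 : ℤ)) (a * (g 0 1 : ℤ) + b * (g 1 1 : ℤ)) := by
  funext τ
  rw [ModularForm.SL_slash_apply, Eis_eq, Eis_eq, ← TS_slash]
  ring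

lemma sigma_char (N : ℕ) [NeZero N] (σ : ℂ ≃+* ℂ) (lam : ℤ)
    (hσ : σ (zetaC N) = zetaC N ^ lam) (x : ZMod N) :
    σ (ZMod.stdAddChar x) = ZMod.stdAddChar ((lam : ZMod N) * x) := by
  have h1 : ∀ z : ℤ, ZMod.stdAddChar (z : ZMod N) = zetaC N ^ z := by
    intro z
    rw [ZMod.stdAddChar_coe, zetaC, ← Complex.exp_int_mul]
    congr 1; ring
  obtain ⟨z, rfl⟩ := ZMod.intCast_surjective x
  rw [h1, map_zpow₀, hσ, ← zpow_mul, ← Int.cast_mul, h1]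

lemma sigma_cf (k N : ℕ) [NeZero N] (σ : ℂ ≃+* ℂ) (lam : ℤ)
    (hσ : σ (zetaC N) = zetaC N ^ lam) (a b : ZMod N) (n : ℕ) :
    σ (cfC k N a b n) = cfC k N a ((lam : ZMod N) * b) n := by
  have h1 : ∀ a b, σ (coefC k N a b n) = coefC k N a ((lam : ZMod N) * b) n := by
    intro a b
    unfold coefC
    rw [map_sum]
    apply Finset.sum_congr rfl
    intro x _
    rw [apply_ite σ, map_mul, map_pow, map_natCast, sigma_char N σ lam hσ, map_zero,
      mul_left_comm]
  have h2 : σ (constC k N b) = constC k N ((lam : ZMod N) * b) := by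
    unfold constC
    rw [map_mul, map_sum, map_div₀, map_pow, map_natCast]
    congr 1
    apply Finset.sum_congr rfl
    intro j _
    rw [map_mul, map_mul, map_ratCast, map_div₀, map_natCast, map_pow, map_neg σ, map_one,
      sigma_char N σ lam hσ]
    congr 2
    ring
  unfold cfC
  rw [map_add, map_add, map_mul, map_pow, map_neg, map_one, h1, h1, apply_ite σ, apply_ite σ, h2,
    map_zero, mul_neg]

/-- Let `N ≥ 1`, `k ≥ 3`, `a b ∈ ℤ/Nℤ`, `g = (A,B;C,D) ∈ SL₂(ℤ)`, and let
`σ` be a field automorphism of `ℂ` with `σ(ζ_N) = ζ_N^λ`, `λ` coprime to `N`; fix `λ'` with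
`λλ' ≡ 1 (mod N)` and let `g_λ ∈ SL₂(ℤ)` be any matrix with `g_λ ≡ (A, λB; λ'C, D) (mod N)`.
Then applying `σ` to the Fourier coefficients of `E^{(k)}_{a,b} |_k g` yields the Fourier
coefficients of `E^{(k)}_{a,λb} |_k g_λ`. -/
theorem stmt_0 (N k : ℕ) (hN : 1 ≤ N) (hk : 3 ≤ k) (a b : ZMod N)
    (g glam : SL(2, ℤ))
    (σ : ℂ ≃+* ℂ) (lam lam' : ℤ) (hlam : IsCoprime lam (N : ℤ))
    (hσ : σ (zetaC N) = zetaC N ^ lam)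
    (hlam' : lam * lam' ≡ 1 [ZMOD (N : ℤ)])
    (hg00 : ((glam 0 0 : ℤ) : ZMod N) = ((g 0 0 : ℤ) : ZMod N))
    (hg01 : ((glam 0 1 : ℤ) : ZMod N) = (lam : ZMod N) * ((g 0 1 : ℤ) : ZMod N))
    (hg10 : ((glam 1 0 : ℤ) : ZMod N) = (lam' : ZMod N) * ((g 1 0 : ℤ) : ZMod N))
    (hg11 : ((glam 1 1 : ℤ) : ZMod N) = ((g 1 1 : ℤ) : ZMod N))
    (c c' : ℕ → ℂ)
    (hc : HasExpansion N (Eis k N a b ∣[(k : ℤ)] g) c)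
    (hc' : HasExpansion N (Eis k N a ((lam : ZMod N) * b) ∣[(k : ℤ)] glam) c') :
    ∀ n : ℕ, σ (c n) = c' n := by
  haveI : NeZero N := ⟨by omega⟩
  rw [slash_Eis] at hc hc'
  have h1 := exp_unique N _ _ _ hc (Eis_expansion k N hk _ _)
  have h2 := exp_unique N _ _ _ hc' (Eis_expansion k N hk _ _)
  intro n
  rw [h1, h2, sigma_cf k N σ lam hσ]
  have hl : (lam : ZMod N) * (lam' : ZMod N) = 1 := by
    have := (ZMod.intCast_eq_intCast_iff _ _ _).mpr hlam'
    simpa using this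
  rw [hg00, hg01, hg10, hg11]
  congr 1
  · linear_combination (-b * ((g 1 0 : ℤ) : ZMod N)) * hl
  · ring
end
end

section
/- Let N ≥ 1 and k ≥ 3 be integers, a, b ∈ ℤ/Nℤ, and let σ be a field automorphism of ℂ with σ(ζ_N) = ζ_N^λ for an integer λ coprime to N. Then for every n ≥ 0 one has σ(a_n(E^{(k)}_{a,b})) = a_n(E^{(k)}_{a,λb}); that is, applying σ to the Fourier coefficients of E^{(k)}_{a,b} yields the Fourier coefficients of E^{(k)}_{a,λb}. -/
open Complex UpperHalfPlane CongruenceSubgroup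
open scoped ModularForm MatrixGroups Real

noncomputable section

lemma zetaC_ne (N : ℕ) : zetaC N ≠ 0 := Complex.exp_ne_zero _

lemma zetaC_zpow (N : ℕ) (m : ℤ) :
    zetaC N ^ m = Complex.exp (2 * Real.pi * Complex.I * m / N) := by
  rw [zetaC, ← Complex.exp_int_mul]; congr 1; ring

lemma zetaC_norm (N : ℕ) (m : ℤ) : ‖zetaC N ^ m‖ = 1 := by
  rw [zetaC_zpow, show (2 * Real.pi * Complex.I * m / N : ℂ) = ((2 * Real.pi * m / N : ℝ) : ℂ) * Complex.I by
    push_cast; ring]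
  exact Complex.norm_exp_ofReal_mul_I _

lemma zetaC_prim (N : ℕ) (hN : 1 ≤ N) : IsPrimitiveRoot (zetaC N) N :=
  Complex.isPrimitiveRoot_exp N (by omega)

lemma zetaC_congr (N : ℕ) (hN : 1 ≤ N) (m n : ℤ) (h : (m : ZMod N) = (n : ZMod N)) :
    zetaC N ^ m = zetaC N ^ n := by
  rw [ZMod.intCast_eq_intCast_iff_dvd_sub] at h
  have := ((zetaC_prim N hN).zpow_eq_one_iff_dvd (n - m)).2 h
  rw [zpow_sub₀ (zetaC_ne N), div_eq_one_iff_eq (zpow_ne_zero _ (zetaC_ne N))] at this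
  exact this.symm

lemma exp_uniq (N : ℕ) (hN : 1 ≤ N) (f : ℍ → ℂ) (c c' : ℕ → ℂ)
    (h : HasExpansion N f c) (h' : HasExpansion N f c') : c = c' := by
  have h0 : (0 : ℝ) < (N : ℝ) := by exact_mod_cast hN
  have hz : UpperHalfPlane.cuspFunction (N : ℝ) (fun _ : ℍ => (0 : ℂ)) = fun _ => 0 := by
    have hp : ∀ q ≠ (0 : ℂ), UpperHalfPlane.cuspFunction (N : ℝ) (fun _ : ℍ => (0 : ℂ)) q = 0 := by
      intro q hq
      exact Function.Periodic.cuspFunction_eq_of_nonzero _ _ hq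
    funext q
    by_cases hq : q = 0
    · subst hq
      unfold UpperHalfPlane.cuspFunction
      rw [Function.Periodic.cuspFunction_zero_eq_limUnder_nhds_ne]
      apply Filter.Tendsto.limUnder_eq
      apply tendsto_const_nhds.congr'
      filter_upwards [self_mem_nhdsWithin] with q hq
      exact (hp q hq).symm
    · exact hp q hq
  have key := UpperHalfPlane.hasFPowerSeriesOnBall_cuspFunction (h := (N : ℝ)) (f := fun _ : ℍ => (0 : ℂ))
    (c := fun n => c n - c' n) h0 (by rw [hz]; exact analyticAt_const) (by
      intro τ
      have := (h τ).sub (h' τ)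
      rw [sub_self] at this
      refine this.congr_fun fun n => ?_
      simp only [Function.Periodic.qParam]
      rw [← Complex.exp_nat_mul, smul_eq_mul, sub_mul]
      have : (n : ℂ) * (2 * Real.pi * Complex.I * (τ : ℂ) / ((N : ℝ) : ℂ)) =
        2 * Real.pi * Complex.I * n * (τ : ℂ) / N := by push_cast; ring
      rw [this])
  rw [hz] at key
  have k2 := HasFPowerSeriesAt.eq_zero key.hasFPowerSeriesAt
  funext n
  have := congrArg (fun p => p.coeff n) k2
  simp [FormalMultilinearSeries.coeff_ofScalars] at this
  exact sub_eq_zero.1 this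

lemma const_term (N k : ℕ) (hN : 1 ≤ N) (hk : 2 ≤ k) : ∃ r : ℕ → ℚ, ∀ b : ℤ,
    ((k - 1).factorial : ℂ) / (-(2 * Real.pi * Complex.I)) ^ k *
      ∑' n : ℤ, (N : ℂ) ^ k / ((n * N + b : ℤ) : ℂ) ^ k =
    ∑ j ∈ Finset.range N, zetaC N ^ (-(b * j)) * (r j : ℂ) := by
  have hN0 : (N : ℂ) ≠ 0 := by exact_mod_cast (by omega : N ≠ 0)
  have hN1 : (0 : ℝ) < (N : ℝ) := by exact_mod_cast hN
  refine ⟨fun j => (N : ℚ) ^ k / N * ((-1) ^ (k + 1) * (k - 1).factorial / k.factorial) *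
    (Polynomial.bernoulli k).eval ((j : ℚ) / N), fun b => ?_⟩
  have hB : ∀ j : ℕ, ((bernoulliFun k ((j : ℝ) / N) : ℝ) : ℂ) =
      (((Polynomial.bernoulli k).eval ((j : ℚ) / N) : ℚ) : ℂ) := by
    intro j
    rw [bernoulliFun, show ((j : ℝ) / N) = algebraMap ℚ ℝ ((j : ℚ) / N) by simp,
      Polynomial.eval_map_apply]
    simp
  have h1 : ∀ j ∈ Finset.range N, HasSum (fun m : ℤ => zetaC N ^ (-(b * j)) *
      (1 / (m : ℂ) ^ k * zetaC N ^ (m * j)))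
      (zetaC N ^ (-(b * j)) * (-(2 * Real.pi * Complex.I) ^ k / k.factorial *
        (((Polynomial.bernoulli k).eval ((j : ℚ) / N) : ℚ) : ℂ))) := by
    intro j hj
    have hj' : (j : ℝ) ≤ N := by exact_mod_cast (Finset.mem_range.1 hj).le
    have := hasSum_one_div_pow_mul_fourier_mul_bernoulliFun hk (x := (j : ℝ) / N)
      ⟨by positivity, by rw [div_le_one hN1]; exact hj'⟩
    rw [hB] at this
    refine HasSum.mul_left _ ?_
    refine this.congr_fun fun m => ?_
    rw [fourier_coe_apply, zetaC_zpow]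
    congr 2
    push_cast
    field_simp
  have h2 := hasSum_sum h1
  have hind : ∀ m : ℤ, ∑ j ∈ Finset.range N, zetaC N ^ (-(b * j)) *
      (1 / (m : ℂ) ^ k * zetaC N ^ (m * j)) =
      if (N : ℤ) ∣ m - b then (N : ℂ) / (m : ℂ) ^ k else 0 := by
    intro m
    have e : ∀ j : ℕ, zetaC N ^ (-(b * j)) * (1 / (m : ℂ) ^ k * zetaC N ^ (m * j)) =
      1 / (m : ℂ) ^ k * (zetaC N ^ (m - b)) ^ j := by
      intro j
      rw [← zpow_natCast (zetaC N ^ (m - b)) j, ← zpow_mul, sub_mul, sub_eq_add_neg, zpow_add₀ (zetaC_ne N)]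
      ring
    simp_rw [e]
    rw [← Finset.mul_sum]
    have hd := (zetaC_prim N hN).zpow_eq_one_iff_dvd (m - b)
    split_ifs with h
    · rw [hd.2 h]; simp; ring
    · have hne : zetaC N ^ (m - b) ≠ 1 := fun h' => h (hd.1 h')
      rw [geom_sum_eq hne]
      have : (zetaC N ^ (m - b)) ^ N = 1 := by
        rw [← zpow_natCast, ← zpow_mul, mul_comm, zpow_mul, zpow_natCast, (zetaC_prim N hN).pow_eq_one, one_zpow]
      rw [this]; simp
  simp_rw [hind] at h2
  have hinj : Function.Injective (fun n : ℤ => n * N + b) := by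
    intro x y hxy
    have : N ≠ 0 := by omega
    simpa [this] using hxy
  rw [← hinj.hasSum_iff] at h2
  · have h3 := h2.mul_left ((N : ℂ) ^ k / N)
    have h4 := (h3.congr_fun (g := fun n : ℤ => (N : ℂ) ^ k / ((n * N + b : ℤ) : ℂ) ^ k)
      (fun n => by
        simp only [Function.comp]
        rw [if_pos (by simp)]
        field_simp)).tsum_eq
    rw [h4, Finset.mul_sum, Finset.mul_sum]
    refine Finset.sum_congr rfl fun j _ => ?_
    have hpi : (2 * Real.pi * Complex.I : ℂ) ≠ 0 := Complex.two_pi_I_ne_zero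
    push_cast
    rw [neg_pow (2 * Real.pi * Complex.I : ℂ)]
    have : (k.factorial : ℂ) ≠ 0 := by exact_mod_cast k.factorial_ne_zero
    have hm : ((-1 : ℂ) ^ k) ≠ 0 := by simp
    have hm2 : ((-1 : ℂ) ^ k) * (-1) ^ k = 1 := by rw [← mul_pow]; simp
    have hp : (2 * Real.pi * Complex.I : ℂ) ^ k ≠ 0 := pow_ne_zero _ hpi
    generalize (2 * Real.pi * Complex.I : ℂ) ^ k = P at *
    rw [pow_succ]
    generalize (-1 : ℂ) ^ k = s at *
    generalize zetaC N ^ (-(b * (j : ℤ))) = zz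
    field_simp
    linear_combination (((k - 1).factorial : ℂ) * zz * (((Polynomial.bernoulli k).eval ((j : ℚ) / N) : ℚ) : ℂ)) * hm2
  · intro x hx
    rw [if_neg]
    intro h
    obtain ⟨t, ht⟩ := h
    exact hx ⟨t, by simp; linarith⟩

lemma lipschitz (N k : ℕ) (hN : 1 ≤ N) (hk : 3 ≤ k) (τ : ℍ) (M : ℕ+) (b : ℤ) :
    ((k - 1).factorial : ℂ) / (-(2 * Real.pi * Complex.I)) ^ k *
      ∑' n : ℤ, (N : ℂ) ^ k / (((M : ℤ) : ℂ) * (τ : ℂ) + ((n * N + b : ℤ) : ℂ)) ^ k =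
    ∑' d : ℕ+, ((d : ℕ) : ℂ) ^ (k - 1) * (zetaC N ^ (b * (d : ℕ)) *
      Complex.exp (2 * Real.pi * Complex.I * (τ : ℂ) / N) ^ ((M : ℕ) * (d : ℕ))) := by
  have hN0 : (N : ℂ) ≠ 0 := by exact_mod_cast (by omega : N ≠ 0)
  have hN1 : (0 : ℝ) < (N : ℝ) := by exact_mod_cast hN
  have him : 0 < ((((M : ℕ) : ℝ) * (τ : ℂ) + (b : ℝ)) / (N : ℝ) : ℂ).im := by
    rw [Complex.div_ofReal_im, Complex.add_im, Complex.im_ofReal_mul, Complex.ofReal_im, add_zero]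
    have h1 : 0 < (τ : ℂ).im := τ.im_pos
    have h2 : (0 : ℝ) < ((M : ℕ) : ℝ) := by exact_mod_cast M.pos
    positivity
  have key := EisensteinSeries.qExpansion_identity_pnat (k := k - 1) (by omega) ⟨_, him⟩
  rw [show k - 1 + 1 = k by omega] at key
  have e1 : ∀ n : ℤ, (N : ℂ) ^ k / (((M : ℤ) : ℂ) * (τ : ℂ) + ((n * N + b : ℤ) : ℂ)) ^ k =
      1 / (((((M : ℕ) : ℝ) * (τ : ℂ) + (b : ℝ)) / (N : ℝ) : ℂ) + n) ^ k := by
    intro n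
    rw [show ((((M : ℕ) : ℝ) * (τ : ℂ) + (b : ℝ)) / (N : ℝ) : ℂ) + n =
      (((M : ℤ) : ℂ) * (τ : ℂ) + ((n * N + b : ℤ) : ℂ)) / N by push_cast; field_simp; ring]
    rw [div_pow, one_div_div]
  simp_rw [e1]
  have key' : ∑' n : ℤ, 1 / (((((M : ℕ) : ℝ) * (τ : ℂ) + (b : ℝ)) / (N : ℝ) : ℂ) + n) ^ k = _ := key
  rw [key', ← mul_assoc]
  have hp : (2 * Real.pi * Complex.I : ℂ) ≠ 0 := Complex.two_pi_I_ne_zero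
  have : ((k - 1).factorial : ℂ) ≠ 0 := by exact_mod_cast (k - 1).factorial_ne_zero
  rw [show (-2 * Real.pi * Complex.I : ℂ) = -(2 * Real.pi * Complex.I) by ring,
    div_mul_div_cancel₀ (pow_ne_zero _ (neg_ne_zero.2 hp)), div_self this, one_mul]
  refine tsum_congr fun d => ?_
  congr 1
  rw [zetaC_zpow, ← Complex.exp_nat_mul, ← Complex.exp_nat_mul, ← Complex.exp_add]
  congr 1
  push_cast
  field_simp
  ring

lemma lipschitz_neg (N k : ℕ) (hN : 1 ≤ N) (hk : 3 ≤ k) (τ : ℍ) (M : ℕ+) (b : ℤ) :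
    ((k - 1).factorial : ℂ) / (-(2 * Real.pi * Complex.I)) ^ k *
      ∑' n : ℤ, (N : ℂ) ^ k / (((-(M : ℤ) : ℤ) : ℂ) * (τ : ℂ) + ((n * N + b : ℤ) : ℂ)) ^ k =
    ∑' d : ℕ+, ((d : ℕ) : ℂ) ^ (k - 1) * (((-1) ^ k * zetaC N ^ (-b * (d : ℕ))) *
      Complex.exp (2 * Real.pi * Complex.I * (τ : ℂ) / N) ^ ((M : ℕ) * (d : ℕ))) := by
  have h := lipschitz N k hN hk τ M (-b)
  have e : ∑' n : ℤ, (N : ℂ) ^ k / (((-(M : ℤ) : ℤ) : ℂ) * (τ : ℂ) + ((n * N + b : ℤ) : ℂ)) ^ k =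
    (-1) ^ k * ∑' n : ℤ, (N : ℂ) ^ k / (((M : ℤ) : ℂ) * (τ : ℂ) + ((n * N + -b : ℤ) : ℂ)) ^ k := by
    rw [← (Equiv.neg ℤ).tsum_eq, ← tsum_mul_left]
    refine tsum_congr fun n => ?_
    rw [show (((-(M : ℤ) : ℤ) : ℂ) * (τ : ℂ) + ((Equiv.neg ℤ n * N + b : ℤ) : ℂ)) =
      -(((M : ℤ) : ℂ) * (τ : ℂ) + ((n * N + -b : ℤ) : ℂ)) by simp; ring, neg_pow
      (((M : ℤ) : ℂ) * (τ : ℂ) + ((n * N + -b : ℤ) : ℂ))]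
    rcases neg_one_pow_eq_or ℂ k with h | h <;> rw [h] <;> simp [div_neg]
  rw [e, mul_left_comm, h, ← tsum_mul_left]
  refine tsum_congr fun d => ?_
  ring

lemma resum (k : ℕ) (q : ℂ) (hq : ‖q‖ < 1) (v : ℕ → ℕ → ℂ) (hv : ∀ m d, ‖v m d‖ ≤ 1) :
    HasSum (fun n : ℕ+ => (∑ x ∈ (n : ℕ).divisorsAntidiagonal, (x.2 : ℂ) ^ (k - 1) * v x.1 x.2) *
      q ^ (n : ℕ))
      (∑' m : ℕ+, ∑' d : ℕ+, ((d : ℕ) : ℂ) ^ (k - 1) * (v m d * q ^ ((m : ℕ) * (d : ℕ)))) := by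
  have hs : Summable (fun c : ℕ+ × ℕ+ => ((c.2 : ℕ) : ℂ) ^ (k - 1) *
      (v c.1 c.2 * q ^ ((c.1 : ℕ) * (c.2 : ℕ)))) := by
    refine Summable.of_norm_bounded (summable_prod_mul_pow (k - 1) hq).norm ?_
    intro c
    rw [norm_mul, norm_mul, norm_mul]
    gcongr
    exact mul_le_of_le_one_left (norm_nonneg _) (hv _ _)
  rw [← hs.tsum_prod]
  have h := hs.hasSum
  rw [← sigmaAntidiagonalEquivProd.hasSum_iff] at h
  refine (h.sigma (fun n => hasSum_fintype _)).congr_fun fun n => ?_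
  rw [Finset.sum_mul, ← Finset.sum_attach]
  refine Finset.sum_congr rfl fun x _ => ?_
  have hx := Nat.mem_divisorsAntidiagonal.1 x.2
  simp only [Function.comp, sigmaAntidiagonalEquivProd, divisorsAntidiagonalFactors, Equiv.coe_fn_mk,
    PNat.mk_coe]
  rw [hx.1, mul_assoc]

def eCoef (N k : ℕ) (r : ℕ → ℚ) (a b : ZMod N) (n : ℕ) : ℂ :=
  if n = 0 then (if a = 0 then ∑ j ∈ Finset.range N, zetaC N ^ (-((b.val : ℤ) * j)) * (r j : ℂ) else 0)
  else (∑ x ∈ n.divisorsAntidiagonal, (x.2 : ℂ) ^ (k - 1) *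
      (if (x.1 : ZMod N) = a then zetaC N ^ ((b.val : ℤ) * (x.2 : ℤ)) else 0)) +
    ∑ x ∈ n.divisorsAntidiagonal, (x.2 : ℂ) ^ (k - 1) *
      (if -(x.1 : ZMod N) = a then (-1) ^ k * zetaC N ^ (-(b.val : ℤ) * (x.2 : ℤ)) else 0)

lemma eis_expansion (N k : ℕ) (hN : 1 ≤ N) (hk : 3 ≤ k) : ∃ r : ℕ → ℚ, ∀ a b : ZMod N,
    HasExpansion N (Eis k N a b) (eCoef N k r a b) := by
  have : NeZero N := ⟨by omega⟩
  obtain ⟨r, hr⟩ := const_term N k hN (by omega)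
  refine ⟨r, fun a b τ => ?_⟩
  have hN1 : (0 : ℝ) < (N : ℝ) := by exact_mod_cast hN
  set C : ℂ := ((k - 1).factorial : ℂ) / (-(2 * Real.pi * Complex.I)) ^ k with hC
  set q : ℂ := Complex.exp (2 * Real.pi * Complex.I * (τ : ℂ) / N) with hqd
  have hq : ‖q‖ < 1 := by
    have := Function.Periodic.norm_qParam_lt_one hN1 τ.im_pos
    simpa [Function.Periodic.qParam] using this
  have hinj : ∀ c : ℤ, Function.Injective (fun n : ℤ => n * N + c) := by
    intro c x y hxy
    have : N ≠ 0 := by omega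
    simpa [this] using hxy
  have hsum : Summable (fun p : ℤ × ℤ => (N : ℂ) ^ k /
        (((p.1 * N + (a.val : ℤ) : ℤ) : ℂ) * (τ : ℂ) + ((p.2 * N + (b.val : ℤ) : ℤ) : ℂ)) ^ k) := by
    have h1 := (summable_prod_eisSummand hk τ).comp_injective
      ((hinj (a.val : ℤ)).prodMap (hinj (b.val : ℤ)))
    refine (h1.mul_left ((N : ℂ) ^ k)).congr fun p => ?_
    simp [EisensteinSeries.eisSummand, div_eq_mul_inv]
  set G : ℤ → ℂ := fun M => if (M : ZMod N) = a then
    C * ∑' n : ℤ, (N : ℂ) ^ k / ((M : ℂ) * (τ : ℂ) + ((n * N + (b.val : ℤ) : ℤ) : ℂ)) ^ k else 0 with hG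
  have hGF : ∀ m : ℤ, G (m * N + (a.val : ℤ)) = C * ∑' n : ℤ, (N : ℂ) ^ k /
        (((m * N + (a.val : ℤ) : ℤ) : ℂ) * (τ : ℂ) + ((n * N + (b.val : ℤ) : ℤ) : ℂ)) ^ k := by
    intro m
    simp only [hG]
    rw [if_pos (by simp)]
  have hsupp : ∀ M ∉ Set.range (fun n : ℤ => n * N + (a.val : ℤ)), G M = 0 := by
    intro M hM
    simp only [hG]
    rw [if_neg]
    intro h
    apply hM
    have : ((a.val : ℤ) : ZMod N) = (M : ZMod N) := by rw [h]; simp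
    rw [ZMod.intCast_eq_intCast_iff_dvd_sub] at this
    obtain ⟨t, ht⟩ := this
    exact ⟨t, by simp only; linarith⟩
  have hGs : Summable G := by
    rw [← (hinj (a.val : ℤ)).summable_iff hsupp]
    exact (hsum.prod.mul_left C).congr fun m => (hGF m).symm
  have hE : Eis k N a b τ = ∑' M : ℤ, G M := by
    rw [← (hinj (a.val : ℤ)).tsum_eq (f := G)]
    · rw [tsum_congr hGF, tsum_mul_left, ← hsum.tsum_prod]
      rfl
    · intro M hM
      by_contra h
      exact hM (hsupp M h)
  have hv1 : ∀ m d : ℕ, ‖(if (m : ZMod N) = a then zetaC N ^ ((b.val : ℤ) * (d : ℤ)) else 0)‖ ≤ 1 := by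
    intro m d
    split_ifs
    · exact (zetaC_norm _ _).le
    · simp
  have hv2 : ∀ m d : ℕ, ‖(if -(m : ZMod N) = a then (-1) ^ k * zetaC N ^ (-(b.val : ℤ) * (d : ℤ)) else 0)‖ ≤ 1 := by
    intro m d
    split_ifs
    · rw [norm_mul, zetaC_norm]; simp
    · simp
  have S := (resum k q hq _ hv1).add (resum k q hq _ hv2)
  have T1 : ∑' m : ℕ+, G m = ∑' m : ℕ+, ∑' d : ℕ+, ((d : ℕ) : ℂ) ^ (k - 1) *
    ((if ((m : ℕ) : ZMod N) = a then zetaC N ^ ((b.val : ℤ) * ((d : ℕ) : ℤ)) else 0) * q ^ ((m : ℕ) * (d : ℕ))) := by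
    refine tsum_congr fun m => ?_
    simp only [hG]
    by_cases h : ((m : ℕ) : ZMod N) = a
    · rw [if_pos (by simpa using h), hC, lipschitz N k hN hk τ m]
      simp only [if_pos h]
      rfl
    · rw [if_neg (by simpa using h)]
      simp [if_neg h]
  have T2 : ∑' m : ℕ+, G (-m) = ∑' m : ℕ+, ∑' d : ℕ+, ((d : ℕ) : ℂ) ^ (k - 1) *
    ((if -((m : ℕ) : ZMod N) = a then (-1) ^ k * zetaC N ^ (-(b.val : ℤ) * ((d : ℕ) : ℤ)) else 0) * q ^ ((m : ℕ) * (d : ℕ))) := by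
    refine tsum_congr fun m => ?_
    simp only [hG]
    by_cases h : -((m : ℕ) : ZMod N) = a
    · rw [if_pos (by simpa using h), hC, lipschitz_neg N k hN hk τ m]
      simp only [if_pos h]
      rfl
    · rw [if_neg (by simpa using h)]
      simp [if_neg h]
  rw [← T1, ← T2] at S
  have h0 : G 0 = eCoef N k r a b 0 := by
    simp only [hG, eCoef]
    by_cases h : a = 0
    · rw [if_pos (by simp [h]), if_pos trivial, if_pos h, ← hr (b.val : ℤ)]
      simp
    · rw [if_neg (by simpa using Ne.symm h), if_pos trivial, if_neg h]
  rw [hE, tsum_int_eq_zero_add_tsum_pnat hGs]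
  have hfin : HasSum (fun n : ℕ => eCoef N k r a b n * q ^ n)
      (∑' m : ℕ+, G m + ∑' m : ℕ+, G (-m) + eCoef N k r a b 0 * q ^ 0) := by
    rw [← hasSum_pnat_iff (f := fun n : ℕ => eCoef N k r a b n * q ^ n)]
    refine S.congr_fun fun n => ?_
    rw [eCoef, if_neg n.ne_zero, add_mul]
  rw [h0, add_assoc, add_comm (eCoef N k r a b 0)]
  rw [pow_zero, mul_one] at hfin
  refine hfin.congr_fun fun n => ?_
  rw [hqd, ← Complex.exp_nat_mul]
  congr 2
  ring

lemma sigma_zeta (N : ℕ) (hN : 1 ≤ N) (b : ZMod N) (σ : ℂ ≃+* ℂ) (lam : ℤ)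
    (hσ : σ (zetaC N) = zetaC N ^ lam) (d : ℤ) :
    σ (zetaC N ^ ((b.val : ℤ) * d)) = zetaC N ^ (((((lam : ZMod N) * b).val : ℕ) : ℤ) * d) := by
  have : NeZero N := ⟨by omega⟩
  rw [map_zpow₀, hσ, ← zpow_mul]
  apply zetaC_congr N hN
  simp [mul_assoc]

/-- Let `N ≥ 1`, `k ≥ 3`, `a b ∈ ℤ/Nℤ`, and let `σ` be a field automorphism
of `ℂ` with `σ(ζ_N) = ζ_N^λ`, `λ` coprime to `N`. Then applying `σ` to the Fourier
coefficients of `E^{(k)}_{a,b}` yields the Fourier coefficients of `E^{(k)}_{a,λb}`. -/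
theorem stmt_1 (N k : ℕ) (hN : 1 ≤ N) (hk : 3 ≤ k) (a b : ZMod N)
    (σ : ℂ ≃+* ℂ) (lam : ℤ) (hlam : IsCoprime lam (N : ℤ))
    (hσ : σ (zetaC N) = zetaC N ^ lam)
    (c c' : ℕ → ℂ)
    (hc : HasExpansion N (Eis k N a b) c)
    (hc' : HasExpansion N (Eis k N a ((lam : ZMod N) * b)) c') :
    ∀ n : ℕ, σ (c n) = c' n := by
  obtain ⟨r, hr⟩ := eis_expansion N k hN hk
  rw [exp_uniq N hN _ _ _ hc (hr _ _), exp_uniq N hN _ _ _ hc' (hr _ _)]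
  have hz := sigma_zeta N hN b σ lam hσ
  intro n
  unfold eCoef
  have hz2 : ∀ d : ℤ, σ (zetaC N ^ (-((b.val : ℤ) * d))) =
      zetaC N ^ (-(((((lam : ZMod N) * b).val : ℕ) : ℤ) * d)) := by
    intro d
    rw [← mul_neg, hz, mul_neg]
  split_ifs with h1 h2
  · rw [map_sum]
    refine Finset.sum_congr rfl fun j _ => ?_
    rw [map_mul, hz2, map_ratCast]
  · exact map_zero σ
  · rw [map_add, map_sum, map_sum]
    congr 1
    · refine Finset.sum_congr rfl fun x _ => ?_
      rw [map_mul, map_pow, map_natCast]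
      split_ifs
      · rw [hz]
      · rw [map_zero]
    · refine Finset.sum_congr rfl fun x _ => ?_
      rw [map_mul, map_pow, map_natCast]
      split_ifs
      · rw [map_mul, map_pow, map_neg, map_one, neg_mul, neg_mul, hz2]
      · rw [map_zero]
end
end

section
/- Let N ≥ 1 and k ≥ 1 be integers, and let f be a modular form of weight k on Γ(N) all of whose Fourier coefficients lie in ℚ(ζ_N), the subfield of ℂ generated by ζ_N. Then for every g ∈ SL₂(ℤ), all Fourier coefficients of f |_k g lie in ℚ(ζ_N). -/
open Complex UpperHalfPlane CongruenceSubgroup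
open scoped ModularForm MatrixGroups Real

noncomputable section

open scoped Manifold

lemma HasSum.congr_fun' {ι : Type*} {f g : ι → ℂ} {a : ℂ} (h : HasSum g a)
    (e : ∀ i, f i = g i) : HasSum f a := by
  rwa [show f = g from funext e]

/-- Expansion with a bundled power series, in terms of `qParam`. -/
def HE (N : ℕ) (f : ℍ → ℂ) (P : PowerSeries ℂ) : Prop :=
  ∀ τ : ℍ, HasSum (fun n : ℕ => P.coeff n * Function.Periodic.qParam N τ ^ n) (f τ)

lemma qpow_eq (N n : ℕ) (τ : ℂ) : Function.Periodic.qParam N τ ^ n =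
    Complex.exp (2 * Real.pi * Complex.I * n * (τ : ℂ) / N) := by
  rw [Function.Periodic.qParam, ← Complex.exp_nat_mul]
  congr 1
  push_cast
  ring

lemma he_iff (N : ℕ) (f : ℍ → ℂ) (P : PowerSeries ℂ) :
    HE N f P ↔ HasExpansion N f (fun n => P.coeff n) := by
  simp only [HE, HasExpansion, qpow_eq]

lemma HE.add {N : ℕ} {f g : ℍ → ℂ} {P Q : PowerSeries ℂ} (hf : HE N f P) (hg : HE N g Q) :
    HE N (f + g) (P + Q) := by
  intro τ
  have := (hf τ).add (hg τ)
  simpa [add_mul] using this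

lemma HE.smul {N : ℕ} {f : ℍ → ℂ} {P : PowerSeries ℂ} (a : ℂ) (hf : HE N f P) :
    HE N (a • f) (a • P) := by
  intro τ
  have := (hf τ).mul_left a
  simpa [mul_assoc] using this

lemma HE.zero (N : ℕ) : HE N 0 0 := by
  intro τ
  simp

lemma HE.sum {N : ℕ} {ι : Type*} (s : Finset ι) {f : ι → ℍ → ℂ} {P : ι → PowerSeries ℂ}
    (hf : ∀ i ∈ s, HE N (f i) (P i)) : HE N (∑ i ∈ s, f i) (∑ i ∈ s, P i) := by
  classical
  induction s using Finset.induction_on with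
  | empty => simpa using HE.zero N
  | insert i s hi ih =>
    rw [Finset.sum_insert hi, Finset.sum_insert hi]
    exact (hf i (by simp)).add (ih fun j hj => hf j (by simp [hj]))

lemma HE.mul {N : ℕ} {f g : ℍ → ℂ} {P Q : PowerSeries ℂ} (hf : HE N f P) (hg : HE N g Q) :
    HE N (f * g) (P * Q) := by
  intro τ
  have h1 := (hf τ).summable.norm
  have h2 := (hg τ).summable.norm
  have h3 := (summable_norm_sum_mul_antidiagonal_of_summable_norm h1 h2).of_norm.hasSum
  rw [← tsum_mul_tsum_eq_tsum_sum_antidiagonal_of_summable_norm h1 h2, (hf τ).tsum_eq,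
    (hg τ).tsum_eq] at h3
  refine HasSum.congr_fun' h3 fun n => ?_
  rw [PowerSeries.coeff_mul, Finset.sum_mul]
  refine Finset.sum_congr rfl fun x hx => ?_
  rw [← Finset.HasAntidiagonal.mem_antidiagonal.mp hx, pow_add]
  ring

lemma HE.hasSum_of_norm_lt {N : ℕ} (hN : 1 ≤ N) {f : ℍ → ℂ} {P : PowerSeries ℂ} (hf : HE N f P)
    {q : ℂ} (hq : ‖q‖ < 1) : HasSum (fun n : ℕ => P.coeff n * q ^ n)
      (∑' n : ℕ, P.coeff n * q ^ n) := by
  have hN' : (0 : ℝ) < (N : ℝ) := by exact_mod_cast hN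
  apply Summable.hasSum
  rcases eq_or_ne q 0 with rfl | hq0
  · apply summable_of_ne_finset_zero (s := {0})
    intro b hb
    simp at hb
    simp [hb]
  · have h1 := Function.Periodic.im_invQParam_pos_of_norm_lt_one hN' hq hq0
    have := (hf ⟨_, h1⟩).summable
    simpa only [Function.Periodic.qParam_right_inv hN'.ne' hq0] using this

lemma HE.fps {N : ℕ} (hN : 1 ≤ N) {f : ℍ → ℂ} {P : PowerSeries ℂ} (hf : HE N f P) :
    HasFPowerSeriesOnBall (fun q : ℂ => ∑' n : ℕ, P.coeff n * q ^ n)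
      (.ofScalars ℂ fun n => P.coeff n) 0 1 := by
  constructor
  · refine le_of_forall_lt_imp_le_of_dense fun r hr ↦ ?_
    lift r to NNReal using hr.ne_top
    apply FormalMultilinearSeries.le_radius_of_summable
    have := (hf.hasSum_of_norm_lt hN (q := (r : ℂ)) (by simpa using hr)).summable.norm
    simpa [smul_eq_mul, norm_mul, mul_comm, mul_left_comm, mul_assoc] using this
  · simp
  · intro y hy
    rw [← ENNReal.coe_one, Metric.eball_coe, NNReal.coe_one, mem_ball_zero_iff] at hy
    have := hf.hasSum_of_norm_lt hN hy
    simpa [mul_comm] using this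

lemma HE.eq_tsum {N : ℕ} {f : ℍ → ℂ} {P : PowerSeries ℂ} (hf : HE N f P) (τ : ℍ) :
    f τ = ∑' n : ℕ, P.coeff n * Function.Periodic.qParam N τ ^ n := (hf τ).tsum_eq.symm

lemma HE.unique {N : ℕ} (hN : 1 ≤ N) {f : ℍ → ℂ} {P Q : PowerSeries ℂ} (hf : HE N f P)
    (hg : HE N f Q) : P = Q := by
  have hN' : (0 : ℝ) < (N : ℝ) := by exact_mod_cast hN
  have h1 := (hf.fps hN).hasFPowerSeriesAt
  have h2 := (hg.fps hN).hasFPowerSeriesAt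
  -- the two functions agree on the punctured ball, hence everywhere by continuity
  have c1 := (hf.fps hN).continuousOn
  have key : (fun q : ℂ => ∑' n : ℕ, P.coeff n * q ^ n) =ᶠ[nhdsWithin 0 {0}ᶜ]
      (fun q : ℂ => ∑' n : ℕ, Q.coeff n * q ^ n) := by
    have hb : Metric.ball (0 : ℂ) 1 ∈ nhds (0 : ℂ) := Metric.ball_mem_nhds _ one_pos
    filter_upwards [mem_nhdsWithin_of_mem_nhds hb, self_mem_nhdsWithin] with q hq hq0
    rw [mem_ball_zero_iff] at hq
    have h1 := Function.Periodic.im_invQParam_pos_of_norm_lt_one hN' hq hq0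
    have e1 := hf.eq_tsum ⟨_, h1⟩
    have e2 := hg.eq_tsum ⟨_, h1⟩
    have e3 : Function.Periodic.qParam (N : ℝ) (Function.Periodic.invQParam (N : ℝ) q) = q :=
      Function.Periodic.qParam_right_inv hN'.ne' hq0
    simp only [e3] at e1 e2
    rw [← e1, ← e2]
  have key2 : (fun q : ℂ => ∑' n : ℕ, P.coeff n * q ^ n) =ᶠ[nhds 0]
      (fun q : ℂ => ∑' n : ℕ, Q.coeff n * q ^ n) :=
    (h1.analyticAt.frequently_eq_iff_eventually_eq h2.analyticAt).mp key.frequently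
  have h3 := (h1.congr key2).eq_formalMultilinearSeries h2
  ext n
  have := congrArg (fun p => FormalMultilinearSeries.coeff p n) h3
  simpa [FormalMultilinearSeries.coeff_ofScalars] using this

lemma HE.mdiff {N : ℕ} (hN : 1 ≤ N) {f : ℍ → ℂ} {P : PowerSeries ℂ} (hf : HE N f P) :
    MDiff f := by
  have hN' : (0 : ℝ) < (N : ℝ) := by exact_mod_cast hN
  rw [UpperHalfPlane.mdifferentiable_iff]
  have h1 : DifferentiableOn ℂ (fun q : ℂ => ∑' n : ℕ, P.coeff n * q ^ n) (Metric.ball 0 1) := by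
    have := (hf.fps hN).differentiableOn
    rwa [← ENNReal.coe_one, Metric.eball_coe, NNReal.coe_one] at this
  have h2 : DifferentiableOn ℂ (fun z : ℂ => Function.Periodic.qParam N z) {z | 0 < z.im} := by
    unfold Function.Periodic.qParam
    fun_prop
  refine (h1.comp h2 ?_).congr ?_
  · intro z hz
    rw [mem_ball_zero_iff]
    exact Function.Periodic.norm_qParam_lt_one hN' hz
  · intro z hz
    simp only [Function.comp]
    rw [hf.eq_tsum, ofComplex_apply_of_im_pos hz]

lemma HE.bdd {N : ℕ} (hN : 1 ≤ N) {f : ℍ → ℂ} {P : PowerSeries ℂ} (hf : HE N f P) :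
    IsBoundedAtImInfty f :=
  isBoundedAtImInfty_of_hasSum_qExpansion (h := N) (c := fun n => P.coeff n)
    (by exact_mod_cast hN) hf

/-- The field `ℚ(ζ_N)`. -/
def KK (N : ℕ) : Subfield ℂ := Subfield.closure {zetaC N}

/-- Power series with coefficients in `K`. -/
def KSer (N : ℕ) (P : PowerSeries ℂ) : Prop := ∀ n, P.coeff n ∈ KK N

lemma KSer.add {N : ℕ} {P Q : PowerSeries ℂ} (hP : KSer N P) (hQ : KSer N Q) : KSer N (P + Q) :=
  fun n => by simpa using add_mem (hP n) (hQ n)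

lemma KSer.mul {N : ℕ} {P Q : PowerSeries ℂ} (hP : KSer N P) (hQ : KSer N Q) : KSer N (P * Q) :=
  fun n => by
    rw [PowerSeries.coeff_mul]
    exact sum_mem fun x _ => mul_mem (hP _) (hQ _)

lemma KSer.smul {N : ℕ} {P : PowerSeries ℂ} {a : ℂ} (ha : a ∈ KK N) (hP : KSer N P) :
    KSer N (a • P) :=
  fun n => by simpa using mul_mem ha (hP n)

lemma exists_proj (K : Subfield ℂ) : ∃ l : ℂ →+ ℂ, (∀ x, l x ∈ K) ∧ (∀ x ∈ K, l x = x) ∧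
    ∀ a ∈ K, ∀ x, l (a * x) = a * l x := by
  obtain ⟨g, hg⟩ := LinearMap.exists_leftInverse_of_injective (Algebra.linearMap K ℂ)
    (LinearMap.ker_eq_bot.mpr (algebraMap K ℂ).injective)
  refine ⟨K.subtype.toAddMonoidHom.comp g.toAddMonoidHom, fun x => (g x).2, ?_, ?_⟩
  · intro x hx
    have := congrArg (fun h => ((h ⟨x, hx⟩ : K) : ℂ)) hg
    exact this
  · intro a ha x
    have := g.map_smul ⟨a, ha⟩ x
    have := congrArg (fun h : K => (h : ℂ)) this
    simpa [Subfield.smul_def] using this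

/-- Coefficientwise application of an additive map. -/
def lamS (l : ℂ →+ ℂ) (P : PowerSeries ℂ) : PowerSeries ℂ := PowerSeries.mk fun n => l (P.coeff n)

lemma KSer.of_mul {N : ℕ} {C H : PowerSeries ℂ} (hH : KSer N H) (h0 : H ≠ 0)
    (hX : KSer N (C * H)) : KSer N C := by
  obtain ⟨l, h1, h2, h3⟩ := exists_proj (KK N)
  have h4 : lamS l C * H = C * H := by
    ext n
    rw [← h2 _ (hX n), PowerSeries.coeff_mul, PowerSeries.coeff_mul, map_sum]
    refine Finset.sum_congr rfl fun x _ => ?_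
    rw [mul_comm (PowerSeries.coeff x.1 C), h3 _ (hH _)]
    simp [lamS, mul_comm]
  have h5 := mul_right_cancel₀ h0 h4
  intro n
  rw [← h5]
  simpa [lamS] using h1 _

/-- All conjugates of `F` have expansions with coefficients in `K`. -/
def Good (N : ℕ) (w : ℤ) (F : ℍ → ℂ) : Prop :=
  ∀ g : SL(2, ℤ), ∃ P, HE N (F ∣[w] g) P ∧ KSer N P

lemma Good.mul {N : ℕ} {a b : ℤ} {F G : ℍ → ℂ} (hF : Good N a F) (hG : Good N b G) :
    Good N (a + b) (F * G) := by
  intro g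
  obtain ⟨P, hP, hP'⟩ := hF g
  obtain ⟨Q, hQ, hQ'⟩ := hG g
  refine ⟨P * Q, ?_, hP'.mul hQ'⟩
  rw [ModularForm.mul_slash_SL2]
  exact hP.mul hQ

lemma Good.add {N : ℕ} {a : ℤ} {F G : ℍ → ℂ} (hF : Good N a F) (hG : Good N a G) :
    Good N a (F + G) := by
  intro g
  obtain ⟨P, hP, hP'⟩ := hF g
  obtain ⟨Q, hQ, hQ'⟩ := hG g
  refine ⟨P + Q, ?_, hP'.add hQ'⟩
  rw [SlashAction.add_slash]
  exact hP.add hQ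

lemma Good.zero (N : ℕ) (a : ℤ) : Good N a 0 := by
  intro g
  refine ⟨0, ?_, fun n => by simp [(KK N).zero_mem]⟩
  rw [SlashAction.zero_slash]
  exact HE.zero N

lemma SL_smul_slash (k : ℤ) (g : SL(2, ℤ)) (c : ℂ) (F : ℍ → ℂ) :
    (c • F) ∣[k] g = c • (F ∣[k] g) := by
  exact ModularForm.SL_smul_slash k g F c

lemma Good.smul {N : ℕ} {a : ℤ} {c : ℂ} {F : ℍ → ℂ} (hc : c ∈ KK N) (hF : Good N a F) :
    Good N a (c • F) := by
  intro g
  obtain ⟨P, hP, hP'⟩ := hF g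
  refine ⟨c • P, ?_, hP'.smul hc⟩
  rw [SL_smul_slash]
  exact hP.smul c

lemma Good.sum {N : ℕ} {a : ℤ} {ι : Type*} (s : Finset ι) {F : ι → ℍ → ℂ}
    (hF : ∀ i ∈ s, Good N a (F i)) : Good N a (∑ i ∈ s, F i) := by
  classical
  induction s using Finset.induction_on with
  | empty => simpa using Good.zero N a
  | insert i s hi ih =>
    rw [Finset.sum_insert hi]
    exact (hF i (by simp)).add (ih fun j hj => hF j (by simp [hj]))

lemma Good.sub {N : ℕ} {a : ℤ} {F G : ℍ → ℂ} (hF : Good N a F) (hG : Good N a G) :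
    Good N a (F - G) := by
  have := hF.add (hG.smul (c := -1) (neg_mem (KK N).one_mem))
  rw [neg_one_smul, ← sub_eq_add_neg] at this
  exact this

/-- The complex span of the good functions. -/
def Spn (N : ℕ) (w : ℤ) : Submodule ℂ (ℍ → ℂ) := Submodule.span ℂ {F | Good N w F}

lemma Good.mem {N : ℕ} {a : ℤ} {F : ℍ → ℂ} (hF : Good N a F) : F ∈ Spn N a :=
  Submodule.subset_span hF

lemma Good.mul_mem {N : ℕ} {a b : ℤ} {F G : ℍ → ℂ} (hF : Good N a F) (hG : G ∈ Spn N b) :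
    F * G ∈ Spn N (a + b) := by
  induction hG using Submodule.span_induction with
  | mem x hx => exact (hF.mul hx).mem
  | zero => rw [mul_zero]; exact zero_mem _
  | add x y _ _ hx hy => rw [mul_add]; exact add_mem hx hy
  | smul c x _ hx => rw [mul_smul_comm]; exact Submodule.smul_mem _ _ hx

lemma good_of_mem {N : ℕ} (hN : 1 ≤ N) {w : ℤ} {F : ℍ → ℂ} (hF : F ∈ Spn N w) {P : PowerSeries ℂ}
    (hP : HE N F P) (hK : KSer N P) : Good N w F := by
  obtain ⟨l, h1, h2, h3⟩ := exists_proj (KK N)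
  -- every element of the span has a good shadow
  have key : ∀ c : ℂ, ∃ Q G, HE N (c • F) Q ∧ Good N w G ∧ HE N G (lamS l Q) := by
    clear hP hK
    induction hF using Submodule.span_induction with
    | mem x hx =>
      intro c
      obtain ⟨Q, hQ, hQ'⟩ := hx 1
      rw [SlashAction.slash_one] at hQ
      refine ⟨c • Q, l c • x, hQ.smul c, hx.smul (h1 c), ?_⟩
      rw [show lamS l (c • Q) = l c • Q by
        ext n
        simp only [lamS, PowerSeries.coeff_mk, PowerSeries.coeff_smul, smul_eq_mul]
        rw [mul_comm, h3 _ (hQ' n), mul_comm]]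
      exact hQ.smul _
    | zero =>
      intro c
      refine ⟨0, 0, by simpa using HE.zero N, Good.zero N w, ?_⟩
      rw [show lamS l 0 = 0 by ext n; simp [lamS]]
      exact HE.zero N
    | add x y _ _ hx hy =>
      intro c
      obtain ⟨Q, G, a1, a2, a3⟩ := hx c
      obtain ⟨R, H, b1, b2, b3⟩ := hy c
      refine ⟨Q + R, G + H, ?_, a2.add b2, ?_⟩
      · rw [smul_add]
        exact a1.add b1
      rw [show lamS l (Q + R) = lamS l Q + lamS l R by ext n; simp [lamS]]
      exact a3.add b3
    | smul c x hx' hx =>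
      intro d
      simpa only [smul_smul] using hx (d * c)
  obtain ⟨Q, G, a1, a2, a3⟩ := key 1
  rw [one_smul] at a1
  obtain rfl := a1.unique hN hP
  rw [show lamS l Q = Q by ext n; simp [lamS, h2 _ (hK n)]] at a3
  have : F = G := by
    ext τ
    rw [hP.eq_tsum, a3.eq_tsum]
  rwa [this]

lemma HE.level {N : ℕ} (hN : 1 ≤ N) {f : ℍ → ℂ} {P : PowerSeries ℂ} (hf : HE 1 f P) :
    HE N f (PowerSeries.mk fun n => if N ∣ n then P.coeff (n / N) else 0) := by
  intro τ
  have hinj : Function.Injective (fun n : ℕ => N * n) := fun a b h => by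
    simpa [show N ≠ 0 by omega] using h
  rw [← hinj.hasSum_iff]
  · refine HasSum.congr_fun' (hf τ) fun n => ?_
    have hN' : (N : ℂ) ≠ 0 := by exact_mod_cast (show N ≠ 0 by omega)
    simp only [Function.comp, PowerSeries.coeff_mk, dvd_mul_right, if_true, qpow_eq]
    rw [Nat.mul_div_cancel_left _ hN]
    congr 2
    push_cast
    field_simp
  · intro n hn
    have : ¬ N ∣ n := fun ⟨m, hm⟩ => hn ⟨m, hm.symm⟩
    simp [this]

lemma good_of_level_one {N : ℕ} (hN : 1 ≤ N) {k : ℤ} (f : ModularForm 𝒮ℒ k)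
    (h : KSer N (qExpansion 1 f)) : Good N k f := by
  intro g
  have h1 : (f : ℍ → ℂ) ∣[k] g = f := SlashInvariantForm.slash_action_eqn f _ ⟨g, rfl⟩
  rw [h1]
  refine ⟨_, HE.level hN (P := qExpansion 1 f) ?_, fun n => ?_⟩
  · intro τ
    have := ModularForm.hasSum_qExpansion f one_pos one_mem_strictPeriods_SL τ
    simpa using this
  · rw [PowerSeries.coeff_mk]
    split_ifs
    · exact h _
    · exact zero_mem _

lemma good_E {N : ℕ} (hN : 1 ≤ N) {k : ℕ} (hk : 3 ≤ k) (hk2 : Even k) :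
    Good N k (ModularForm.E hk) := by
  refine good_of_level_one hN _ fun n => ?_
  rw [EisensteinSeries.E_qExpansion_coeff hk hk2]
  split_ifs
  · exact one_mem _
  · refine mul_mem (neg_mem (div_mem (mul_mem ?_ (natCast_mem _ _)) ?_)) (natCast_mem _ _)
    · exact_mod_cast natCast_mem (KK N) 2
    · exact SubfieldClass.ratCast_mem (KK N) _

lemma Good.cast {N : ℕ} {a b : ℤ} {F : ℍ → ℂ} (hF : Good N a F) (h : a = b) : Good N b F := h ▸ hF

lemma good_disc {N : ℕ} (hN : 1 ≤ N) : Good N 12 ModularForm.discriminant := by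
  have h4 := good_E hN (k := 4) (by norm_num) ⟨2, rfl⟩
  have h6 := good_E hN (k := 6) (by norm_num) ⟨3, rfl⟩
  have h1 := ((h4.mul h4).mul h4).cast (b := 12) (by norm_num)
  have h2 := (h6.mul h6).cast (b := 12) (by norm_num)
  have h3 := (h1.sub h2).smul (c := ((1 / 1728 : ℚ) : ℂ)) (SubfieldClass.ratCast_mem (KK N) _)
  refine Eq.mp (congrArg (Good N 12) ?_) h3
  symm
  ext z
  rw [ModularForm.discriminant_eq_E₄_cube_sub_E₆_sq]
  simp only [Pi.smul_apply, Pi.sub_apply, Pi.mul_apply, smul_eq_mul]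
  push_cast
  unfold ModularForm.E₄ ModularForm.E₆
  ring

lemma good_one (N : ℕ) : Good N 0 1 := by
  intro g
  have h1 : (1 : ℍ → ℂ) ∣[(0 : ℤ)] g = 1 := by
    ext z
    simp [ModularForm.SL_slash_apply]
  rw [h1]
  refine ⟨1, ?_, fun n => ?_⟩
  · intro τ
    have := hasSum_ite_eq (0 : ℕ) (1 : ℂ)
    refine HasSum.congr_fun' this fun n => ?_
    rw [PowerSeries.coeff_one]
    split_ifs with h
    · simp [h]
    · simp
  · rw [PowerSeries.coeff_one]
    split_ifs
    · exact one_mem _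
    · exact zero_mem _

lemma level_one_mem_nat {N : ℕ} (hN : 1 ≤ N) (k : ℕ) : ∀ (f : ModularForm 𝒮ℒ (k : ℤ)),
    (f : ℍ → ℂ) ∈ Spn N k := by
  induction k using Nat.strong_induction_on with | _ k ih =>
  intro f
  have hz : f = 0 → (f : ℍ → ℂ) ∈ Spn N k := by
    rintro rfl
    exact zero_mem _
  rcases Nat.even_or_odd k with hk | hk
  swap
  · exact hz (ModularForm.levelOne_odd_weight_eq_zero (by exact_mod_cast hk) f)
  rcases Nat.eq_zero_or_pos k with rfl | hpos
  · obtain ⟨c, hc⟩ := ModularFormClass.levelOne_weight_zero_const f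
    rw [hc, show Function.const ℍ c = c • (1 : ℍ → ℂ) by ext; simp]
    exact Submodule.smul_mem _ _ (good_one N).mem
  by_cases h3 : 3 ≤ k
  swap
  · obtain rfl : k = 2 := by
      obtain ⟨m, rfl⟩ := hk
      omega
    exact hz (rank_zero_iff_forall_zero.mp ModularForm.levelOne_weight_two_rank_zero f)
  set c := (qExpansion 1 f).coeff 0 with hc
  set f' : ModularForm 𝒮ℒ (k : ℤ) := f - c • ModularForm.E h3 with hf'
  have h0 : (qExpansion 1 f').coeff 0 = 0 := by
    have e1 : qExpansion 1 f' = qExpansion 1 f - qExpansion 1 (c • ModularForm.E h3) :=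
      ModularForm.qExpansion_sub one_pos one_mem_strictPeriods_SL f (c • ModularForm.E h3)
    have e2 : qExpansion 1 (c • ModularForm.E h3) = c • qExpansion 1 (ModularForm.E h3) :=
      ModularForm.qExpansion_smul one_pos one_mem_strictPeriods_SL c (ModularForm.E h3)
    rw [e1, e2, map_sub, PowerSeries.coeff_smul, EisensteinSeries.E_qExpansion_coeff_zero h3 hk, ← hc]
    simp
  set g := CuspForm.discriminantEquiv (f'.toCuspForm h0) with hg
  have hfg : (f : ℍ → ℂ) = c • (ModularForm.E h3 : ℍ → ℂ) + ModularForm.discriminant * g := by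
    rw [hg, ModularForm.discriminant_mul_discriminantEquiv]
    ext z
    simp [ModularForm.toCuspForm_apply, hf']
  rw [hfg]
  refine add_mem (Submodule.smul_mem _ _ (good_E hN h3 hk).mem) ?_
  have hg' : (g : ℍ → ℂ) ∈ Spn N ((k : ℤ) - 12) := by
    by_cases h12 : 12 ≤ k
    · obtain ⟨m, rfl⟩ := Nat.exists_eq_add_of_le h12
      have e : ((12 + m : ℕ) : ℤ) - 12 = (m : ℤ) := by
        push_cast
        ring
      have h' : (g : ℍ → ℂ) ∈ Spn N (m : ℤ) := ih m (by omega) (ModularForm.mcast e g)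
      rw [show Spn N (((12 + m : ℕ) : ℤ) - 12) = Spn N (m : ℤ) by rw [e]]
      exact h'
    · rw [rank_zero_iff_forall_zero.mp (ModularForm.levelOne_neg_weight_rank_zero (by omega)) g]
      exact zero_mem _
  have := (good_disc hN).mul_mem hg'
  simpa using this

lemma level_one_mem {N : ℕ} (hN : 1 ≤ N) (k : ℤ) (f : ModularForm 𝒮ℒ k) :
    (f : ℍ → ℂ) ∈ Spn N k := by
  rcases lt_or_ge k 0 with h | h
  · rw [rank_zero_iff_forall_zero.mp (ModularForm.levelOne_neg_weight_rank_zero h) f]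
    exact zero_mem _
  · lift k to ℕ using h
    exact level_one_mem_nat hN k f

lemma trace_data {N : ℕ} (hN : 1 ≤ N) : ∃ (ι : Type) (_ : Fintype ι) (γ : ι → SL(2, ℤ)) (i0 : ι),
    γ i0 ∈ CongruenceSubgroup.Gamma N ∧ (∀ i, i ≠ i0 → γ i ∉ CongruenceSubgroup.Gamma N) ∧
    ∀ (W : ℤ) (F : ModularForm (Gamma N) W), ∑ i, (F : ℍ → ℂ) ∣[W] γ i ∈ Spn N W := by
  have : NeZero N := ⟨by omega⟩
  let Γ : Subgroup (GL (Fin 2) ℝ) := (Gamma N : Subgroup (GL (Fin 2) ℝ))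
  let Q := 𝒮ℒ ⧸ (Γ.subgroupOf 𝒮ℒ)
  have : Finite Q := inferInstanceAs (Finite (𝒮ℒ ⧸ (Γ.subgroupOf 𝒮ℒ)))
  let : Fintype Q := Fintype.ofFinite Q
  have hex : ∀ q : Q, ∃ g : SL(2, ℤ), ∃ h : 𝒮ℒ, (QuotientGroup.mk h : Q) = q ∧
      h.val⁻¹ = Matrix.SpecialLinearGroup.mapGL ℝ g := by
    intro q
    obtain ⟨h, rfl⟩ := QuotientGroup.mk_surjective q
    obtain ⟨g, hg⟩ := h.2
    exact ⟨g⁻¹, h, rfl, by rw [map_inv, hg]⟩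
  choose γ h hq hγ using hex
  have hmem : ∀ q, γ q ∈ CongruenceSubgroup.Gamma N ↔ q = (QuotientGroup.mk 1 : Q) := by
    intro q
    have e1 : q = (QuotientGroup.mk 1 : Q) ↔ (QuotientGroup.mk 1 : Q) = QuotientGroup.mk (h q) := by
      rw [hq q, eq_comm]
    rw [e1, QuotientGroup.eq, Subgroup.mem_subgroupOf]
    simp only [inv_one, one_mul]
    rw [← inv_mem_iff (x := (h q : GL (Fin 2) ℝ)), hγ q]
    constructor
    · intro hh
      exact ⟨_, hh, rfl⟩
    · rintro ⟨x, hx, hx'⟩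
      rwa [← Matrix.SpecialLinearGroup.mapGL_injective hx']
  refine ⟨Q, inferInstance, γ, QuotientGroup.mk 1, (hmem _).2 rfl,
    fun i hi h => hi ((hmem i).1 h), fun W F => ?_⟩
  have := level_one_mem hN W (ModularForm.trace 𝒮ℒ F)
  rw [ModularForm.coe_trace] at this
  convert! this using 2 with q
  conv_rhs => rw [← hq q]
  have := SlashInvariantForm.quotientFunc_mk (ℋ := 𝒮ℒ) F (h q)
  rw [hγ q] at this
  exact this.symm

/-- `F` is a modular form for `Γ(N)`. -/
def IsMF (N : ℕ) (W : ℤ) (F : ℍ → ℂ) : Prop := ∃ f : ModularForm (Gamma N) W, (f : ℍ → ℂ) = F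

lemma IsMF.mul {N : ℕ} {a b : ℤ} {F G : ℍ → ℂ} (hF : IsMF N a F) (hG : IsMF N b G) :
    IsMF N (a + b) (F * G) := by
  obtain ⟨f, rfl⟩ := hF
  obtain ⟨g, rfl⟩ := hG
  exact ⟨f.mul g, rfl⟩

lemma trace_prod {N : ℕ} {ι κ : Type*} [Fintype ι] [DecidableEq κ] (γ : ι → SL(2, ℤ))
    (hT : ∀ (W : ℤ) (F : ModularForm (Gamma N) W), ∑ i, (F : ℍ → ℂ) ∣[W] γ i ∈ Spn N W)
    (w : κ → ℤ) (e e' : κ → ℍ → ℂ) (he : ∀ i, Good N (w i) (e i))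
    (he' : ∀ i, IsMF N (w i) (e' i)) (s : Finset κ) :
    ∀ W F, IsMF N W F → ∑ q, (F ∣[W] γ q) * ∏ i ∈ s, (e i - e' i ∣[w i] γ q) ∈
      Spn N (W + ∑ i ∈ s, w i) := by
  induction s using Finset.induction_on with
  | empty =>
    rintro W _ ⟨f, rfl⟩
    simpa using hT W f
  | insert j s hj ih =>
    intro W F hF
    have h1 := (he j).mul_mem (ih W F hF)
    have h2 := ih _ _ (hF.mul (he' j))
    rw [show w j + (W + ∑ i ∈ s, w i) = W + ∑ i ∈ insert j s, w i by
      rw [Finset.sum_insert hj]; ring] at h1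
    rw [show W + w j + (∑ i ∈ s, w i) = W + ∑ i ∈ insert j s, w i by
      rw [Finset.sum_insert hj]; ring] at h2
    have h3 := sub_mem h1 h2
    rw [Finset.mul_sum, ← Finset.sum_sub_distrib] at h3
    convert! h3 using 2 with q
    rw [Finset.prod_insert hj, ModularForm.mul_slash_SL2]
    ring

lemma HE.eq_zero {N : ℕ} {f : ℍ → ℂ} (h : HE N f 0) : f = 0 := by
  ext τ
  have := h.eq_tsum τ
  simpa using this

lemma HE.ne_zero {N : ℕ} {f : ℍ → ℂ} {P : PowerSeries ℂ} (h : HE N f P) (hf : f ≠ 0) : P ≠ 0 := by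
  rintro rfl
  exact hf h.eq_zero

lemma HE.ne_zero' {N : ℕ} (hN : 1 ≤ N) {f : ℍ → ℂ} {P : PowerSeries ℂ} (h : HE N f P) (hP : P ≠ 0) :
    f ≠ 0 := by
  rintro rfl
  exact hP (h.unique hN (HE.zero N))

lemma Good.exp {N : ℕ} {w : ℤ} {F : ℍ → ℂ} (hF : Good N w F) : ∃ P, HE N F P ∧ KSer N P := by
  simpa using hF 1

lemma slash_ne_zero {w : ℤ} {F : ℍ → ℂ} (h : F ≠ 0) (g : SL(2, ℤ)) : F ∣[w] g ≠ 0 := by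
  intro h0
  apply h
  have := congrArg (fun G => G ∣[w] g⁻¹) h0
  simpa [← SlashAction.slash_mul, SlashAction.zero_slash] using this

lemma Good.mul_ne_zero {N : ℕ} (hN : 1 ≤ N) {a b : ℤ} {F G : ℍ → ℂ} (hF : Good N a F)
    (hG : Good N b G) (hF0 : F ≠ 0) (hG0 : G ≠ 0) : F * G ≠ 0 := by
  obtain ⟨P, hP, -⟩ := hF.exp
  obtain ⟨Q, hQ, -⟩ := hG.exp
  exact (hP.mul hQ).ne_zero' hN (_root_.mul_ne_zero (hP.ne_zero hF0) (hQ.ne_zero hG0))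

lemma Good.prod {N : ℕ} (hN : 1 ≤ N) {κ : Type*} (s : Finset κ) (w : κ → ℤ)
    (F : κ → ℍ → ℂ) (hF : ∀ i, Good N (w i) (F i)) (h0 : ∀ i, F i ≠ 0) :
    Good N (∑ i ∈ s, w i) (∏ i ∈ s, F i) ∧ ∏ i ∈ s, F i ≠ 0 := by
  classical
  induction s using Finset.induction_on with
  | empty =>
    simp only [Finset.sum_empty, Finset.prod_empty]
    refine ⟨good_one N, fun h => ?_⟩
    simpa using congrFun h I
  | insert i s hi ih =>
    rw [Finset.sum_insert hi, Finset.prod_insert hi]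
    exact ⟨(hF i).mul ih.1, (hF i).mul_ne_zero hN ih.1 (h0 i) ih.2⟩

lemma main_of_sep {N : ℕ} (hN : 1 ≤ N)
    (sep : ∀ h : SL(2, ℤ), h ∉ CongruenceSubgroup.Gamma N → ∃ (w : ℤ) (e e' : ℍ → ℂ),
      Good N w e ∧ Good N w e' ∧ IsMF N w e' ∧ e' ∣[w] h = e ∧ e ≠ e')
    {k : ℤ} (f : ModularForm (Gamma N) k) {P : PowerSeries ℂ} (hP : HE N f P) (hK : KSer N P)
    (g : SL(2, ℤ)) {C : PowerSeries ℂ} (hC : HE N (⇑f ∣[k] g) C) : KSer N C := by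
  classical
  obtain ⟨ι, _, γ, i0, h0, h1, hT⟩ := trace_data hN
  let κ := {i // i ≠ i0}
  choose w e e' he he' hM hs hne using fun i : κ => sep (γ i) (h1 i i.2)
  have hfix : ∀ (W : ℤ) (F : ModularForm (Gamma N) W), (F : ℍ → ℂ) ∣[W] γ i0 = F := fun W F =>
    SlashInvariantForm.slash_action_eqn F _ ⟨γ i0, h0, rfl⟩
  have key := trace_prod γ hT w e e' he hM Finset.univ k f ⟨f, rfl⟩
  rw [Finset.sum_eq_single i0] at key
  rotate_left
  · intro q _ hq
    rw [Finset.prod_eq_zero (Finset.mem_univ (⟨q, hq⟩ : κ)), mul_zero]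
    rw [← hs ⟨q, hq⟩, sub_self]
  · intro h
    exact absurd (Finset.mem_univ _) h
  have hfix' : ∀ i, e' i ∣[w i] γ i0 = e' i := fun i => by
    obtain ⟨F, hF⟩ := hM i
    rw [← hF]
    exact hfix _ F
  simp only [hfix, hfix'] at key
  obtain ⟨hG, hG0⟩ := Good.prod hN Finset.univ w (fun i => e i - e' i)
    (fun i => (he i).sub (he' i)) (fun i => sub_ne_zero.2 (hne i))
  obtain ⟨H, hH, hHK⟩ := hG.exp
  have hfG := good_of_mem hN key (hP.mul hH) (hK.mul hHK)
  obtain ⟨X, hX, hXK⟩ := hfG g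
  obtain ⟨Y, hY, hYK⟩ := hG g
  rw [ModularForm.mul_slash_SL2] at hX
  refine KSer.of_mul hYK (hY.ne_zero (slash_ne_zero hG0 g)) ?_
  rw [(hC.mul hY).unique hN hX]
  exact hXK

lemma hasSum_divisors (c : ℕ → ℕ → ℂ) (q : ℂ)
    (h : Summable fun p : ℕ+ × ℕ+ => c p.1 p.2 * q ^ ((p.1 : ℕ) * (p.2 : ℕ))) :
    HasSum (fun n : ℕ => (∑ x ∈ n.divisorsAntidiagonal, c x.1 x.2) * q ^ n)
      (∑' p : ℕ+ × ℕ+, c p.1 p.2 * q ^ ((p.1 : ℕ) * (p.2 : ℕ))) := by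
  have h1 := h.hasSum
  rw [← sigmaAntidiagonalEquivProd.hasSum_iff] at h1
  have h2 := h1.sigma (g := fun n : ℕ+ => (∑ x ∈ (n : ℕ).divisorsAntidiagonal, c x.1 x.2) * q ^ (n : ℕ)) ?_
  · rw [← PNat.coe_injective.hasSum_iff]
    · exact h2
    · intro n hn
      have : n = 0 := by
        by_contra h0
        exact hn ⟨⟨n, Nat.pos_of_ne_zero h0⟩, rfl⟩
      simp [this]
  · intro n
    have := hasSum_fintype fun x : (n : ℕ).divisorsAntidiagonal => c x.1.1 x.1.2 * q ^ (n : ℕ)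
    rw [Finset.univ_eq_attach,
      (n : ℕ).divisorsAntidiagonal.sum_attach (fun x => c x.1 x.2 * q ^ (n : ℕ)),
      ← Finset.sum_mul] at this
    refine HasSum.congr_fun' this fun x => ?_
    have h3 := (Nat.mem_divisorsAntidiagonal.mp x.2).1
    simp only [Function.comp, sigmaAntidiagonalEquivProd, divisorsAntidiagonalFactors,
      Equiv.coe_fn_mk, PNat.mk_coe]
    rw [h3]

lemma psi_val {N : ℕ} [NeZero N] (b : ZMod N) :
    ZMod.stdAddChar b = cexp (2 * π * Complex.I * b.val / N) := by
  have := ZMod.stdAddChar_coe (N := N) (b.val : ℤ)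
  simpa using this

lemma psi_mem {N : ℕ} [NeZero N] (b : ZMod N) : ZMod.stdAddChar b ∈ KK N := by
  have : ZMod.stdAddChar b = zetaC N ^ b.val := by
    rw [psi_val, zetaC, ← Complex.exp_nat_mul]
    congr 1
    ring
  rw [this]
  exact pow_mem (Subfield.subset_closure (Set.mem_singleton _)) _

lemma lipschitz_s3 {N : ℕ} [NeZero N] {k : ℕ} (hk : 1 ≤ k) (z : ℍ) (b : ZMod N) :
    ∑' n : ℤ, (if (n : ZMod N) = b then ((z : ℂ) + n) ^ (-((k + 1 : ℕ) : ℤ)) else 0) =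
      ((-2 * π * Complex.I) ^ (k + 1) / (k.factorial * N ^ (k + 1))) *
        ∑' r : ℕ+, (r : ℂ) ^ k * ZMod.stdAddChar (b * ((r : ℕ) : ZMod N)) *
          Function.Periodic.qParam N z ^ (r : ℕ) := by
  have hN : (0 : ℝ) < N := by exact_mod_cast Nat.pos_of_ne_zero (NeZero.ne N)
  have hNC : (N : ℂ) ≠ 0 := by exact_mod_cast NeZero.ne N
  have hinj : Function.Injective fun j : ℤ => (N : ℤ) * j + b.val := by
    intro x y h
    have : (N : ℤ) ≠ 0 := by exact_mod_cast NeZero.ne N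
    have h2 : (N : ℤ) * x = N * y := by simpa using h
    exact mul_left_cancel₀ this h2
  rw [← hinj.tsum_eq]
  · let z' : ℍ := ⟨((z : ℂ) + b.val) / N, by
      rw [show ((z : ℂ) + b.val) / N = ((z : ℂ) + b.val) / ((N : ℝ) : ℂ) by simp, Complex.div_ofReal_im]
      have : ((z : ℂ) + b.val).im = z.im := by
        rw [Complex.add_im, Complex.natCast_im, add_zero]
        rfl
      rw [this]
      exact div_pos z.im_pos hN⟩
    have hz' : (z' : ℂ) = ((z : ℂ) + b.val) / N := rfl
    have key := EisensteinSeries.qExpansion_identity_pnat hk z'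
    rw [hz'] at key
    have e1 : ∀ j : ℤ, (if (((N : ℤ) * j + b.val : ℤ) : ZMod N) = b then
        ((z : ℂ) + ((N : ℤ) * j + b.val : ℤ)) ^ (-((k + 1 : ℕ) : ℤ)) else 0) =
        ((N : ℂ) ^ (k + 1))⁻¹ * (1 / (((z : ℂ) + b.val) / N + j) ^ (k + 1)) := by
      intro j
      rw [if_pos (by simp), zpow_neg, zpow_natCast, one_div, ← mul_inv, ← mul_pow]
      congr 2
      push_cast
      field_simp
      ring
    rw [tsum_congr e1, tsum_mul_left, key, ← mul_assoc]
    congr 1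
    · field_simp
    · refine tsum_congr fun r => ?_
      rw [mul_assoc ((r : ℂ) ^ k)]
      congr 1
      rw [Function.Periodic.qParam, mul_comm b, ← nsmul_eq_mul, AddChar.map_nsmul_eq_pow, ← mul_pow, psi_val,
        ← Complex.exp_add]
      congr 2
      push_cast
      ring
  · intro n hn
    simp only [Function.mem_support, ne_eq, ite_eq_right_iff, not_forall] at hn
    obtain ⟨h1, -⟩ := hn
    have h2 : ((n : ℤ) : ZMod N) = ((b.val : ℤ) : ZMod N) := by simp [h1]
    rw [ZMod.intCast_eq_intCast_iff_dvd_sub] at h2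
    obtain ⟨j, hj⟩ := h2
    refine ⟨-j, ?_⟩
    simp only
    linarith

lemma const_mem {N : ℕ} [NeZero N] {k : ℕ} (hk : 2 ≤ k) (b : ZMod N) :
    ((2 * π * Complex.I) ^ k)⁻¹ * ∑' n : ℤ, (if (n : ZMod N) = b then (n : ℂ) ^ (-(k : ℤ)) else 0) ∈
      KK N := by
  have hN : (0 : ℝ) < N := by exact_mod_cast Nat.pos_of_ne_zero (NeZero.ne N)
  have hNC : (N : ℂ) ≠ 0 := by exact_mod_cast NeZero.ne N
  have h1 : ∀ j : ZMod N, HasSum (fun n : ℤ => (n : ℂ) ^ (-(k : ℤ)) * ZMod.stdAddChar (j * ((n : ZMod N) - b)))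
      (ZMod.stdAddChar (-(j * b)) * (-(2 * π * Complex.I) ^ k / (k.factorial : ℂ) *
        (((Polynomial.bernoulli k).eval ((j.val : ℚ) / N) : ℚ) : ℂ))) := by
    intro j
    have hx : ((j.val : ℝ) / N) ∈ Set.Icc (0 : ℝ) 1 := by
      refine ⟨by positivity, ?_⟩
      rw [div_le_one hN]
      exact_mod_cast (ZMod.val_lt j).le
    have := (hasSum_one_div_pow_mul_fourier_mul_bernoulliFun hk hx).mul_left
      (ZMod.stdAddChar (-(j * b)))
    have e : bernoulliFun k ((j.val : ℝ) / N) =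
        (((Polynomial.bernoulli k).eval ((j.val : ℚ) / N) : ℚ) : ℝ) := by
      rw [bernoulliFun]
      have := Polynomial.eval_map_apply (f := algebraMap ℚ ℝ) (p := Polynomial.bernoulli k) ((j.val : ℚ) / N)
      rw [map_div₀, map_natCast, map_natCast] at this
      exact this
    rw [e] at this
    have e2 : (((((Polynomial.bernoulli k).eval ((j.val : ℚ) / N) : ℚ) : ℝ)) : ℂ) =
        (((Polynomial.bernoulli k).eval ((j.val : ℚ) / N) : ℚ) : ℂ) := by norm_cast
    rw [e2] at this
    refine HasSum.congr_fun' this fun n => ?_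
    rw [zpow_neg, zpow_natCast, one_div, mul_left_comm]
    congr 1
    rw [mul_sub, sub_eq_neg_add, AddChar.map_add_eq_mul]
    congr 1
    rw [fourier_coe_apply]
    have e3 := ZMod.stdAddChar_coe (N := N) ((j.val : ℤ) * n)
    push_cast at e3
    rw [ZMod.natCast_zmod_val] at e3
    rw [e3]
    congr 1
    push_cast
    field_simp
  have h2 := hasSum_sum (s := Finset.univ) fun j _ => h1 j
  have h3 : ∀ n : ℤ, ∑ j : ZMod N, (n : ℂ) ^ (-(k : ℤ)) * ZMod.stdAddChar (j * ((n : ZMod N) - b)) =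
      N * (if (n : ZMod N) = b then (n : ℂ) ^ (-(k : ℤ)) else 0) := by
    intro n
    rw [← Finset.mul_sum, AddChar.sum_mulShift _ (ZMod.isPrimitive_stdAddChar N), ZMod.card]
    simp only [sub_eq_zero]
    split_ifs
    · ring
    · simp
  simp only [h3] at h2
  have h4 := h2.tsum_eq
  rw [tsum_mul_left] at h4
  have hpi : (2 * π * Complex.I) ^ k ≠ 0 := pow_ne_zero _ Complex.two_pi_I_ne_zero
  have h5 : ((2 * π * Complex.I) ^ k)⁻¹ * ∑' n : ℤ, (if (n : ZMod N) = b then (n : ℂ) ^ (-(k : ℤ)) else 0)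
      = (N : ℂ)⁻¹ * ∑ j : ZMod N, ZMod.stdAddChar (-(j * b)) * (-(k.factorial : ℂ)⁻¹ *
        (((Polynomial.bernoulli k).eval ((j.val : ℚ) / N) : ℚ) : ℂ)) := by
    rw [← mul_right_injective₀ hNC |>.eq_iff, ← mul_right_injective₀ hpi |>.eq_iff]
    rw [mul_left_comm (N : ℂ), mul_inv_cancel_left₀ hpi, h4, mul_inv_cancel_left₀ hNC, Finset.mul_sum]
    refine Finset.sum_congr rfl fun j _ => ?_
    ring
  rw [h5]
  refine mul_mem (inv_mem (natCast_mem _ _)) (sum_mem fun j _ => mul_mem (psi_mem _)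
    (mul_mem (neg_mem (inv_mem (natCast_mem _ _))) (SubfieldClass.ratCast_mem (KK N) _)))

/-- Eisenstein series of level `N`. -/
def GE (N : ℕ) (w : ℕ) (v : Fin 2 → ZMod N) (τ : ℍ) : ℂ :=
  ∑' x : Fin 2 → ℤ, if (fun i => (x i : ZMod N)) = v then
    EisensteinSeries.eisSummand w x τ else 0

open Matrix in
lemma GE_aux (N : ℕ) (v : Fin 2 → ZMod N) (M M' : Matrix (Fin 2) (Fin 2) ℤ) (hgg : M * M' = 1)
    (hgg' : M' * M = 1) (F : (Fin 2 → ℤ) → ℂ) :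
    (∑' x : Fin 2 → ℤ, if (fun i => (x i : ZMod N)) = v then F (x ᵥ* M) else 0) =
    ∑' x : Fin 2 → ℤ, if (fun i => (x i : ZMod N)) = v ᵥ* (M.map (Int.castRingHom (ZMod N)))
      then F x else 0 := by
  let σ : (Fin 2 → ℤ) ≃ (Fin 2 → ℤ) :=
    { toFun := fun x => x ᵥ* M
      invFun := fun x => x ᵥ* M'
      left_inv := fun x => by simp only [vecMul_vecMul, hgg, vecMul_one]
      right_inv := fun x => by simp only [vecMul_vecMul, hgg', vecMul_one] }
  symm
  rw [← σ.tsum_eq]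
  symm
  refine tsum_congr fun x => ?_
  have h1 : (fun i => ((σ x i : ℤ) : ZMod N)) =
      (fun i => (x i : ZMod N)) ᵥ* (M.map (Int.castRingHom (ZMod N))) := by
    ext i
    exact RingHom.map_vecMul (Int.castRingHom (ZMod N)) M x i
  have hA : (M.map (Int.castRingHom (ZMod N))) * (M'.map (Int.castRingHom (ZMod N))) = 1 := by
    rw [← Matrix.map_mul, hgg]
    simp
  have h2 : (fun i => ((σ x i : ℤ) : ZMod N)) = v ᵥ* (M.map (Int.castRingHom (ZMod N))) ↔
      (fun i => (x i : ZMod N)) = v := by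
    rw [h1]
    constructor
    · intro h
      have := congrArg (fun y => y ᵥ* (M'.map (Int.castRingHom (ZMod N)))) h
      simpa only [vecMul_vecMul, hA, vecMul_one] using this
    · rintro rfl
      rfl
  exact (if_congr h2 rfl rfl).symm

/-- The reduced matrix. -/
def redM (N : ℕ) (g : SL(2, ℤ)) : Matrix (Fin 2) (Fin 2) (ZMod N) :=
  Matrix.map (g : Matrix (Fin 2) (Fin 2) ℤ) (Int.castRingHom (ZMod N))

open Matrix in
lemma GE_slash (N w : ℕ) (v : Fin 2 → ZMod N) (g : SL(2, ℤ)) :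
    GE N w v ∣[(w : ℤ)] g = GE N w (v ᵥ* redM N g) := by
  ext τ
  rw [ModularForm.SL_slash_apply]
  have h1 := congrArg Subtype.val (mul_inv_cancel g)
  have h2 := congrArg Subtype.val (inv_mul_cancel g)
  have := GE_aux N v _ _ h1 h2 (fun x => EisensteinSeries.eisSummand w x τ)
  unfold GE redM
  refine Eq.trans ?_ this
  rw [mul_comm, ← tsum_mul_left]
  refine tsum_congr fun x => ?_
  split_ifs
  · rw [EisensteinSeries.eisSummand_SL2_apply, ← mul_assoc, ← zpow_add₀ (denom_ne_zero _ _),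
      neg_add_cancel, zpow_zero, one_mul]
  · simp

lemma summable_d {N : ℕ} [NeZero N] (k : ℕ) (d : ℕ → ℕ → ℂ) (hd : ∀ m r, ‖d m r‖ ≤ 1) (τ : ℍ) :
    Summable fun p : ℕ+ × ℕ+ => ((p.2 : ℕ) : ℂ) ^ k * d p.1 p.2 *
      Function.Periodic.qParam N τ ^ ((p.1 : ℕ) * (p.2 : ℕ)) := by
  have h := (summable_prod_mul_pow k (UpperHalfPlane.norm_qParam_lt_one N τ)).norm
  refine Summable.of_norm_bounded h fun p => ?_
  rw [norm_mul, norm_mul, norm_mul]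
  gcongr
  exact mul_le_of_le_one_right (norm_nonneg _) (hd _ _)

lemma half_sum {N : ℕ} [NeZero N] (k : ℕ) (hk : 1 ≤ k) (s : ℕ → Prop) [DecidablePred s] (b : ZMod N)
    (τ : ℍ) :
    HasSum (fun n : ℕ => (∑ x ∈ n.divisorsAntidiagonal, ((x.2 : ℂ) ^ k *
        if s x.1 then ZMod.stdAddChar (b * (x.2 : ZMod N)) else 0)) * Function.Periodic.qParam N τ ^ n)
      (((-2 * π * Complex.I) ^ (k + 1) / (k.factorial * N ^ (k + 1)))⁻¹ *
        ∑' m : ℕ+, if s m then ∑' n : ℤ, (if (n : ZMod N) = b then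
          (((m : ℕ) : ℂ) * τ + n) ^ (-((k + 1 : ℕ) : ℤ)) else 0) else 0) := by
  have hs := summable_d (N := N) k
    (fun m r => if s m then ZMod.stdAddChar (b * (r : ZMod N)) else 0)
    (fun m r => by
      split_ifs
      · exact (AddChar.norm_apply _ _).le
      · simp) τ
  have h1 := hasSum_divisors (fun m r => (r : ℂ) ^ k *
        if s m then ZMod.stdAddChar (b * (r : ZMod N)) else 0) _ hs
  convert! h1 using 1
  rw [hs.tsum_prod, ← tsum_mul_left]
  refine tsum_congr fun m => ?_
  split_ifs with hm
  · have hκ : ((-2 * π * Complex.I) ^ (k + 1) / (k.factorial * N ^ (k + 1)) : ℂ) ≠ 0 := by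
      refine div_ne_zero (pow_ne_zero _ ?_) (mul_ne_zero ?_ (pow_ne_zero _ ?_))
      · simp [Real.pi_ne_zero]
      · exact_mod_cast Nat.factorial_ne_zero k
      · exact_mod_cast NeZero.ne N
    let z : ℍ := ⟨(m : ℕ) * (τ : ℂ), by
      have : ((m : ℕ) * (τ : ℂ)).im = (m : ℕ) * τ.im := by simp
      rw [this]
      exact mul_pos (by exact_mod_cast m.pos) τ.im_pos⟩
    have key := lipschitz_s3 hk z b
    have hz : (z : ℂ) = (m : ℕ) * (τ : ℂ) := rfl
    rw [hz] at key
    rw [key, inv_mul_cancel_left₀ hκ]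
    refine tsum_congr fun r => ?_
    congr 1
    rw [pow_mul]
    congr 1
    rw [Function.Periodic.qParam, Function.Periodic.qParam, ← Complex.exp_nat_mul]
    congr 1
    ring
  · simp

lemma GE_prod {N : ℕ} {k : ℕ} (hk : 2 ≤ k) (v : Fin 2 → ZMod N) (τ : ℍ) :
    HasSum (fun m : ℤ => if (m : ZMod N) = v 0 then ∑' n : ℤ, (if (n : ZMod N) = v 1 then
          ((m : ℂ) * τ + n) ^ (-((k + 1 : ℕ) : ℤ)) else 0) else 0) (GE N (k + 1) v τ) := by
  have h0 := summable_prod_eisSummand (k := k + 1) (by omega) τ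
  have h1 := h0.indicator {p : ℤ × ℤ | (p.1 : ZMod N) = v 0 ∧ (p.2 : ZMod N) = v 1}
  have h2 : GE N (k + 1) v τ = ∑' p : ℤ × ℤ,
      Set.indicator {p : ℤ × ℤ | (p.1 : ZMod N) = v 0 ∧ (p.2 : ZMod N) = v 1}
        (fun x : ℤ × ℤ => EisensteinSeries.eisSummand (k + 1 : ℕ) ![x.1, x.2] τ) p := by
    unfold GE
    rw [← (finTwoArrowEquiv ℤ).symm.tsum_eq]
    refine tsum_congr fun p => ?_
    rw [Set.indicator_apply]
    refine if_congr ?_ rfl rfl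
    rw [funext_iff, Fin.forall_fin_two]
    simp
  rw [h2]
  have h3 := h1.hasSum.prod_fiberwise fun m => (h1.prod_factor m).hasSum
  refine HasSum.congr_fun' h3 fun m => ?_
  split_ifs with hm
  · refine tsum_congr fun n => ?_
    rw [Set.indicator_apply]
    refine if_congr (by simp [hm]) ?_ rfl
    simp [EisensteinSeries.eisSummand]
  · symm
    refine (tsum_congr fun n => ?_).trans tsum_zero
    rw [Set.indicator_of_notMem]
    simp [hm]

/-- Divisor sums. -/
def DS {N : ℕ} [NeZero N] (k : ℕ) (s : ℕ → Prop) [DecidablePred s] (b : ZMod N) (n : ℕ) : ℂ :=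
  ∑ x ∈ n.divisorsAntidiagonal, ((x.2 : ℂ) ^ k *
        if s x.1 then ZMod.stdAddChar (b * (x.2 : ZMod N)) else 0)

lemma DS_mem {N : ℕ} [NeZero N] (k : ℕ) (s : ℕ → Prop) [DecidablePred s] (b : ZMod N) (n : ℕ) :
    DS k s b n ∈ KK N := by
  refine sum_mem fun x _ => mul_mem (pow_mem (natCast_mem _ _) _) ?_
  split_ifs
  · exact psi_mem _
  · exact zero_mem _

lemma DS_one {N : ℕ} [NeZero N] (k : ℕ) (s : ℕ → Prop) [DecidablePred s] (b : ZMod N) :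
    DS k s b 1 = if s 1 then ZMod.stdAddChar b else 0 := by
  simp [DS]

/-- The Fourier series of the normalised Eisenstein series. -/
def PE {N : ℕ} [NeZero N] (k : ℕ) (v : Fin 2 → ZMod N) : PowerSeries ℂ :=
  PowerSeries.mk fun n => (if n = 0 then (if v 0 = 0 then ((2 * π * Complex.I) ^ (k + 1))⁻¹ *
    ∑' n : ℤ, (if (n : ZMod N) = v 1 then (n : ℂ) ^ (-((k + 1 : ℕ) : ℤ)) else 0) else 0) else 0) +
    ((-1) ^ (k + 1) / (k.factorial * N ^ (k + 1))) *
      (DS k (fun m => (m : ZMod N) = v 0) (v 1) n +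
        (-1) ^ (k + 1) * DS k (fun m => -(m : ZMod N) = v 0) (-v 1) n)

lemma PE_K {N : ℕ} [NeZero N] {k : ℕ} (hk : 2 ≤ k) (v : Fin 2 → ZMod N) : KSer N (PE k v) := by
  intro n
  have h1 : ((-1) ^ (k + 1) : ℂ) ∈ KK N := pow_mem (neg_mem (one_mem _)) _
  rw [PE, PowerSeries.coeff_mk]
  refine add_mem ?_ (mul_mem (div_mem h1 (mul_mem (natCast_mem _ _) (pow_mem (natCast_mem _ _) _)))
    (add_mem (DS_mem _ _ _ _) (mul_mem h1 (DS_mem _ _ _ _))))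
  split_ifs
  · exact const_mem (by omega) _
  · exact zero_mem _
  · exact zero_mem _

lemma PE_HE {N : ℕ} [NeZero N] {k : ℕ} (hk : 2 ≤ k) (v : Fin 2 → ZMod N) :
    HE N (((2 * π * Complex.I) ^ (k + 1) : ℂ)⁻¹ • GE N (k + 1) v) (PE k v) := by
  intro τ
  have hG := GE_prod hk v τ
  have hG' := hG.tsum_eq
  rw [tsum_int_eq_zero_add_tsum_pnat hG.summable] at hG'
  have h1 := half_sum k (by omega) (fun m => (m : ZMod N) = v 0) (v 1) τ
  have h2 := half_sum k (by omega) (fun m => -(m : ZMod N) = v 0) (-v 1) τ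
  have hneg : ∀ m : ℕ+, (if ((-(m : ℤ) : ℤ) : ZMod N) = v 0 then ∑' n : ℤ, (if (n : ZMod N) = v 1 then
          (((-(m : ℤ) : ℤ) : ℂ) * τ + n) ^ (-((k + 1 : ℕ) : ℤ)) else 0) else 0) =
      (-1) ^ (k + 1) * (if -((m : ℕ) : ZMod N) = v 0 then ∑' n : ℤ, (if (n : ZMod N) = -v 1 then
          (((m : ℕ) : ℂ) * τ + n) ^ (-((k + 1 : ℕ) : ℤ)) else 0) else 0) := by
    intro m
    push_cast
    rw [mul_ite, mul_zero]
    refine if_congr (by simp) ?_ rfl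
    rw [← tsum_mul_left, ← (Equiv.neg ℤ).tsum_eq]
    refine tsum_congr fun n => ?_
    rw [mul_ite, mul_zero]
    refine if_congr (by simp [neg_eq_iff_eq_neg]) ?_ rfl
    rw [show ((-(m : ℕ) : ℂ) * τ + ((Equiv.neg ℤ) n : ℤ)) = (-1) * ((m : ℕ) * τ + n) by
      simp only [Equiv.neg_apply]; push_cast; ring]
    rw [mul_zpow]
    congr 1
    rw [zpow_neg, ← inv_zpow]
    norm_num
    norm_cast
  have hκ : ((-2 * π * Complex.I) ^ (k + 1) / (k.factorial * N ^ (k + 1)) : ℂ) ≠ 0 := by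
    refine div_ne_zero (pow_ne_zero _ ?_) (mul_ne_zero ?_ (pow_ne_zero _ ?_))
    · simp [Real.pi_ne_zero]
    · exact_mod_cast Nat.factorial_ne_zero k
    · exact_mod_cast NeZero.ne N
  have hpi : ((2 * π * Complex.I) ^ (k + 1) : ℂ) ≠ 0 := pow_ne_zero _ Complex.two_pi_I_ne_zero
  have hκ2 : ((-2 * π * Complex.I) ^ (k + 1) / (k.factorial * N ^ (k + 1)) : ℂ) =
      (2 * π * Complex.I) ^ (k + 1) * ((-1) ^ (k + 1) / (k.factorial * N ^ (k + 1))) := by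
    rw [show (-2 * π * Complex.I : ℂ) = (2 * π * Complex.I) * (-1) by ring, mul_pow]
    ring
  have h0 := hasSum_ite_eq (0 : ℕ) (if v 0 = 0 then ((2 * π * Complex.I) ^ (k + 1))⁻¹ *
    ∑' n : ℤ, (if (n : ZMod N) = v 1 then (n : ℂ) ^ (-((k + 1 : ℕ) : ℤ)) else 0) else 0)
  have h3 := h0.add ((h1.add (h2.mul_left ((-1) ^ (k + 1)))).mul_left
    ((-1) ^ (k + 1) / (k.factorial * N ^ (k + 1)) : ℂ))
  rw [tsum_congr hneg, tsum_mul_left] at hG'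
  simp only [Int.cast_natCast, Int.cast_zero, zero_mul, zero_add, eq_comm (a := (0 : ZMod N))] at hG'
  have h4 : HasSum (fun n => (PE k v).coeff n * Function.Periodic.qParam N τ ^ n) _ :=
    HasSum.congr_fun' h3 fun n => by
      rw [PE, PowerSeries.coeff_mk, add_mul, DS, DS]
      congr 1
      · split_ifs with h
        · simp [h]
        · simp
        · simp
      · ring
  convert! h4 using 1
  rw [Pi.smul_apply, ← hG', smul_eq_mul, mul_add, mul_add, mul_ite, mul_zero, add_assoc]
  congr 1
  rw [hκ2] at hκ ⊢
  have hκ3 := right_ne_zero_of_mul hκ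
  generalize ((-1) ^ (k + 1) / (k.factorial * N ^ (k + 1)) : ℂ) = K at *
  have helper : ∀ (X K S1 S2 e : ℂ), X ≠ 0 → K ≠ 0 → X⁻¹*S1 + X⁻¹*(e*S2) = K*((X*K)⁻¹*S1 + e*((X*K)⁻¹*S2)) := by
    intro X K S1 S2 e hX hK
    field_simp
  convert! helper _ _ _ _ _ hpi hκ3 using 2

/-- Normalised Eisenstein series. -/
def En (N k : ℕ) (v : Fin 2 → ZMod N) : ℍ → ℂ :=
  ((2 * π * Complex.I) ^ (k + 1) : ℂ)⁻¹ • GE N (k + 1) v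

lemma En_slash (N k : ℕ) (v : Fin 2 → ZMod N) (g : SL(2, ℤ)) :
    En N k v ∣[((k + 1 : ℕ) : ℤ)] g = En N k (Matrix.vecMul v (redM N g)) := by
  rw [En, SL_smul_slash, GE_slash, En]

lemma En_good {N : ℕ} [NeZero N] {k : ℕ} (hk : 2 ≤ k) (v : Fin 2 → ZMod N) :
    Good N ((k + 1 : ℕ) : ℤ) (En N k v) := by
  intro g
  rw [En_slash]
  exact ⟨_, PE_HE hk _, PE_K hk _⟩

lemma redM_of_mem {N : ℕ} {g : SL(2, ℤ)} (hg : g ∈ CongruenceSubgroup.Gamma N) :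
    redM N g = 1 := by
  rw [CongruenceSubgroup.Gamma_mem] at hg
  ext i j
  fin_cases i <;> fin_cases j <;> simp [redM, hg]

lemma En_MF {N : ℕ} [NeZero N] {k : ℕ} (hk : 2 ≤ k) (v : Fin 2 → ZMod N) :
    IsMF N ((k + 1 : ℕ) : ℤ) (En N k v) := by
  have hN : 1 ≤ N := NeZero.one_le
  refine ⟨{ toFun := En N k v
            slash_action_eq' := ?_
            holo' := (PE_HE hk v).mdiff hN
            bdd_at_cusps' := ?_ }, rfl⟩
  · rintro _ ⟨γ, hγ, rfl⟩
    have := En_slash N k v γ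
    rw [redM_of_mem hγ, Matrix.vecMul_one] at this
    exact this
  · intro c hc
    rw [Subgroup.IsArithmetic.isCusp_iff_isCusp_SL2Z] at hc
    rw [OnePoint.isBoundedAt_iff_forall_SL2Z hc]
    intro γ _
    have h := (PE_HE hk (Matrix.vecMul v (redM N γ))).bdd hN
    have := En_slash N k v γ
    rw [En] at this
    exact this ▸ h

lemma PE_one {N : ℕ} [NeZero N] (k : ℕ) (v : Fin 2 → ZMod N) : (PE k v).coeff 1 =
    ((-1) ^ (k + 1) / (k.factorial * N ^ (k + 1))) *
      ((if 1 = v 0 then ZMod.stdAddChar (v 1) else 0) +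
        (-1) ^ (k + 1) * (if -1 = v 0 then ZMod.stdAddChar (-v 1) else 0)) := by
  rw [PE, PowerSeries.coeff_mk, DS_one, DS_one]
  simp

lemma En_one {N : ℕ} [NeZero N] {k : ℕ} (hk : 2 ≤ k) {v v' : Fin 2 → ZMod N}
    (h : En N k v = En N k v') :
      (if 1 = v 0 then (ZMod.stdAddChar (v 1) : ℂ) else 0) +
        (-1) ^ (k + 1) * (if -1 = v 0 then ZMod.stdAddChar (-v 1) else 0) =
      (if 1 = v' 0 then ZMod.stdAddChar (v' 1) else 0) +
        (-1) ^ (k + 1) * (if -1 = v' 0 then ZMod.stdAddChar (-v' 1) else 0) := by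
  have h1 : HE N (En N k v) (PE k v) := PE_HE hk v
  have h2 : HE N (En N k v) (PE k v') := by rw [h]; exact PE_HE hk v'
  have h3 := congrArg (PowerSeries.coeff 1) (HE.unique NeZero.one_le h1 h2)
  rw [PE_one, PE_one] at h3
  refine mul_left_cancel₀ ?_ h3
  refine div_ne_zero (by simp) (mul_ne_zero ?_ (pow_ne_zero _ ?_))
  · exact_mod_cast Nat.factorial_ne_zero k
  · exact_mod_cast NeZero.ne N

lemma En_inj {N : ℕ} [NeZero N] {v v' : Fin 2 → ZMod N} (hv : v 0 = 1)
    (h2 : En N 2 v = En N 2 v') (h3 : En N 3 v = En N 3 v') : v = v' := by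
  have e2 := En_one (by norm_num) h2
  have e3 := En_one (by norm_num) h3
  rw [if_pos hv.symm] at e2 e3
  have e : (ZMod.stdAddChar (v 1) : ℂ) = if 1 = v' 0 then ZMod.stdAddChar (v' 1) else 0 := by
    linear_combination (e2 + e3) / 2
  split_ifs at e with h
  · have := ZMod.injective_stdAddChar e
    ext i
    fin_cases i
    · exact hv.trans h
    · exact this
  · exact absurd e (AddChar.val_isUnit _ _).ne_zero

lemma sep {N : ℕ} (hN : 1 ≤ N) (h : SL(2, ℤ)) (hh : h ∉ CongruenceSubgroup.Gamma N) :
    ∃ (w : ℤ) (e e' : ℍ → ℂ),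
      Good N w e ∧ Good N w e' ∧ IsMF N w e' ∧ e' ∣[w] h = e ∧ e ≠ e' := by
  have : NeZero N := ⟨by omega⟩
  have hv : ∃ v : Fin 2 → ZMod N, v 0 = 1 ∧ v ≠ Matrix.vecMul v (redM N h) := by
    by_contra! hc
    apply hh
    have h1 := hc ![1, 0] rfl
    have h2 := hc ![1, 1] rfl
    have a := congrFun h1 0
    have b := congrFun h1 1
    have c := congrFun h2 0
    have d := congrFun h2 1
    simp [redM, Matrix.vecMul, dotProduct, Fin.sum_univ_two] at a b c d
    rw [CongruenceSubgroup.Gamma_mem]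
    refine ⟨a.symm, b.symm, ?_, ?_⟩
    · linear_combination a - c
    · linear_combination b - d
  obtain ⟨v, hv0, hv⟩ := hv
  have hk : ∃ k, 2 ≤ k ∧ En N k v ≠ En N k (Matrix.vecMul v (redM N h)) := by
    by_contra! hc
    exact hv (En_inj hv0 (hc 2 le_rfl) (hc 3 (by norm_num)))
  obtain ⟨k, hk, hne⟩ := hk
  exact ⟨_, _, En N k v, En_good hk _, En_good hk v, En_MF hk v, En_slash N k v h, hne.symm⟩

/-- Let `f` be a modular form of weight `k ≥ 1` on `Γ(N)` all of whose
Fourier coefficients lie in `ℚ(ζ_N)`, the subfield of `ℂ` generated by `ζ_N`. Then for every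
`g ∈ SL₂(ℤ)`, all Fourier coefficients of `f|_k g` lie in `ℚ(ζ_N)`. -/
theorem stmt_3 (N : ℕ) (hN : 1 ≤ N) (k : ℤ) (hk : 1 ≤ k)
    (f : ModularForm (Gamma N) k)
    (cf : ℕ → ℂ) (hcf : HasExpansion N (⇑f) cf)
    (hQ : ∀ n : ℕ, cf n ∈ Subfield.closure {zetaC N}) :
    ∀ g : SL(2, ℤ), ∀ c : ℕ → ℂ, HasExpansion N (⇑f ∣[k] g) c →
      ∀ n : ℕ, c n ∈ Subfield.closure {zetaC N} := by
  intro g c hc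
  have h1 : HE N (⇑f) (PowerSeries.mk cf) := by
    rw [he_iff]; simpa using hcf
  have h2 : HE N (⇑f ∣[k] g) (PowerSeries.mk c) := by
    rw [he_iff]; simpa using hc
  have h3 : KSer N (PowerSeries.mk cf) := fun n => by
    rw [PowerSeries.coeff_mk]; exact hQ n
  have h4 := main_of_sep hN (fun h hh => sep hN h hh) f h1 h3 g h2
  intro n
  have := h4 n
  rw [PowerSeries.coeff_mk] at this
  exact this
end
end
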